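/- arXiv:math/0001049 — 3 statements merged into one kernel-verified Lean document; each statement's English description precedes it below -/
import Mathlib

section
/- Let K be a field, S a positive normal affine semigroup with gp(S) = ℤ^r, R = K[S], and let σ : R → P = K[Y_1,…,Y_s] be the standard embedding sending the monomial of x ∈ S to Y^{σ(x)}. Let 𝔪 be the maximal ideal of R generated by all nonunit monomials, let λ be the maximal length of a sequence of monomials in 𝔪 that is a regular sequence on R, let grade(𝔪P) be the maximal length of a P-regular sequence contained in the extended ideal 𝔪P, and for c ∈ Cl(R) = ℤ^s/σ(ℤ^r) let depth_R M_c be the length of a maximal M_c-regular sequence in 𝔪, where M_c ⊆ P is the K-span of all monomials of P with residue class −c modulo σ(ℤ^r). Then λ ≤ grade(𝔪P) = min{depth_R M_c : c ∈ Cl(R)}. -/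
set_option synthInstance.maxHeartbeats 1000000
set_option maxHeartbeats 1000000

open scoped BigOperators

noncomputable section

/-- Pairing of an integral linear form (given by its coefficient vector `f`) with `x`. -/
def lin {r : ℕ} (f x : Fin r → ℤ) : ℤ := ∑ k, f k * x k

lemma lin_zero {r : ℕ} (f : Fin r → ℤ) : lin f 0 = 0 := by simp [lin]

lemma lin_add {r : ℕ} (f x y : Fin r → ℤ) : lin f (x + y) = lin f x + lin f y := by
  simp [lin, mul_add, Finset.sum_add_distrib]

/-- A family of integral linear forms, bundled as an additive homomorphism `ℤ^r → ℤ^s`. -/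
def formsHom {r s : ℕ} (σ : Fin s → Fin r → ℤ) : (Fin r → ℤ) →+ (Fin s → ℤ) where
  toFun x i := lin (σ i) x
  map_zero' := by funext i; simp [lin_zero]
  map_add' x y := by funext i; simp [lin_add]

/-- The subgroup `σ(ℤ^r) ⊆ ℤ^s`. -/
def formsRange {r s : ℕ} (σ : Fin s → Fin r → ℤ) : AddSubgroup (Fin s → ℤ) :=
  (formsHom σ).range

/-- The divisor class group `Cl(R) = ℤ^s / σ(ℤ^r)`. -/
abbrev classGroup {r s : ℕ} (σ : Fin s → Fin r → ℤ) : Type :=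
  (Fin s → ℤ) ⧸ formsRange σ

/-- The set of solutions of the inhomogeneous system of inequalities `σ_i(x) ≥ a_i`. -/
def Tset {r s : ℕ} (σ : Fin s → Fin r → ℤ) (a : Fin s → ℤ) : Set (Fin r → ℤ) :=
  {x | ∀ i, a i ≤ lin (σ i) x}

/-- The monomial of exponent `t ∈ ℤ_+^s` in the polynomial ring `P = K[Y_1,…,Y_s]`,
realized as `AddMonoidAlgebra K (Fin s → ℕ)`. -/
def monoN (K : Type*) [Field K] {s : ℕ} (t : Fin s → ℕ) :
    AddMonoidAlgebra K (Fin s → ℕ) :=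
  AddMonoidAlgebra.single t 1

/-- The exponent vector `σ(x) ∈ ℤ_+^s` of the standard embedding (for `x ∈ S` all
`σ_i(x)` are nonnegative). -/
def stdExp {r s : ℕ} (σ : Fin s → Fin r → ℤ) (x : Fin r → ℤ) : Fin s → ℕ :=
  fun i => (lin (σ i) x).toNat

/-- `R = K[S]` inside the polynomial ring `P = K[Y_1,…,Y_s]` via the standard
embedding `x ↦ Y^{σ(x)}`. -/
def stdRingP (K : Type*) [Field K] {r s : ℕ} (S : AddSubmonoid (Fin r → ℤ))
    (σ : Fin s → Fin r → ℤ) : Subalgebra K (AddMonoidAlgebra K (Fin s → ℕ)) :=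
  Algebra.adjoin K {f | ∃ x ∈ S, f = monoN K (stdExp σ x)}

/-- The maximal ideal `𝔪 ⊆ R` generated by all nonunit monomials of `R`. -/
def irrIdealP (K : Type*) [Field K] {r s : ℕ} (S : AddSubmonoid (Fin r → ℤ))
    (σ : Fin s → Fin r → ℤ) : Ideal ↥(stdRingP K S σ) :=
  Ideal.span {f | ∃ x ∈ S, x ≠ 0 ∧
    (f : AddMonoidAlgebra K (Fin s → ℕ)) = monoN K (stdExp σ x)}

/-- The extended ideal `𝔪P ⊆ P` generated by all nonunit monomials of `R`. -/
def extIdealP (K : Type*) [Field K] {r s : ℕ} (S : AddSubmonoid (Fin r → ℤ))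
    (σ : Fin s → Fin r → ℤ) : Ideal (AddMonoidAlgebra K (Fin s → ℕ)) :=
  Ideal.span {f | ∃ x ∈ S, x ≠ 0 ∧ f = monoN K (stdExp σ x)}

/-- The coset module `M_c ⊆ P` representing the divisor class `c ∈ Cl(R) = ℤ^s/σ(ℤ^r)`:
the span of all monomials of `P` whose exponent has residue class `−c`. -/
def cosetModuleP (K : Type*) [Field K] {r s : ℕ} (S : AddSubmonoid (Fin r → ℤ))
    (σ : Fin s → Fin r → ℤ) (c : classGroup σ) :
    Submodule ↥(stdRingP K S σ) (AddMonoidAlgebra K (Fin s → ℕ)) :=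
  Submodule.span _ {f | ∃ t : Fin s → ℕ,
    QuotientAddGroup.mk' (formsRange σ) (fun i => (t i : ℤ)) = -c ∧ f = monoN K t}

section Rees
open CategoryTheory CategoryTheory.Abelian RingTheory.Sequence Pointwise

universe u

variable {A : Type u} [CommRing A]

/-- If multiplication by `a` annihilates `N`, vanishing of `Ext N (M ⧸ aM)` in degree `i` implies
vanishing of `Ext N M` in degree `i + 1`. -/
lemma subsingleton_ext_succ_of_quotSMulTop {N M : ModuleCat.{u} A} {a : A}
    (ha : a ∈ Module.annihilator A N) (hreg : IsSMulRegular M a) (i : ℕ)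
    (h : Subsingleton (Ext N (ModuleCat.of A (QuotSMulTop a M)) i)) :
    Subsingleton (Ext N M (i + 1)) := by
  have hmono : Mono (AddCommGrpCat.ofHom
      ((Ext.mk₀ (ModuleCat.smulShortComplex M a).f).postcomp N (add_zero (i + 1)))) :=
    (Ext.covariant_sequence_exact₁' N hreg.smulShortComplex_shortExact i (i + 1) rfl).mono_g
      ((AddCommGrpCat.isZero_of_iff_subsingleton.mpr h).eq_zero_of_src _)
  have hzero : AddCommGrpCat.ofHom
      ((Ext.mk₀ (ModuleCat.smulShortComplex M a).f).postcomp N (add_zero (i + 1))) = 0 :=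
    Ext.postcomp_smul_id_eq_zero_of_mem_annihilator ha (i + 1)
  exact AddCommGrpCat.subsingleton_of_isZero (Limits.IsZero.of_mono_eq_zero _ hzero)

/-- Along a weakly regular sequence of length `n` annihilating `N`, the modules `Ext N M i` vanish
for `i < n`, and `Ext N M n` vanishes iff there are no nonzero maps from `N` to the quotient. -/
theorem subsingleton_ext_of_isWeaklyRegular (N : ModuleCat.{u} A) (rs : List A)
    (hann : ∀ a ∈ rs, a ∈ Module.annihilator A N) (M : ModuleCat.{u} A)
    (hreg : IsWeaklyRegular M rs) :
    (∀ i < rs.length, Subsingleton (Ext N M i)) ∧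
      (Subsingleton (Ext N M rs.length) ↔
        Subsingleton (N →ₗ[A] M ⧸ (Ideal.ofList rs • ⊤ : Submodule A M))) := by
  induction rs generalizing M with
  | nil =>
    refine ⟨by simp, ?_⟩
    have e : (M ⧸ (Ideal.ofList ([] : List A) • ⊤ : Submodule A M)) ≃ₗ[A] M :=
      Submodule.quotEquivOfEqBot _ (by
        rw [Ideal.ofList_nil]; exact Submodule.bot_smul _)
    exact (Ext.addEquiv₀.trans ModuleCat.homAddEquiv).toEquiv.subsingleton_congr.trans
      (e.congrRight (M := N)).toEquiv.subsingleton_congr.symm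
  | cons a rs ih =>
    rw [isWeaklyRegular_cons_iff] at hreg
    have ha := hann a List.mem_cons_self
    obtain ⟨ih1, ih2⟩ := ih (fun b hb => hann b (List.mem_cons_of_mem _ hb))
      (ModuleCat.of A (QuotSMulTop a M)) hreg.2
    have h1 : ∀ i < (a :: rs).length, Subsingleton (Ext N M i) := by
      rintro (_ | i) hi
      · have : Subsingleton (N →ₗ[A] M) := by
          refine ⟨fun f g => LinearMap.ext fun x => hreg.1 ?_⟩
          simp only [← map_smul, Module.mem_annihilator.mp ha x, map_zero]
        exact (Ext.addEquiv₀.trans ModuleCat.homAddEquiv).subsingleton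
      · exact subsingleton_ext_succ_of_quotSMulTop ha hreg.1 i (ih1 i (by simpa using hi))
    refine ⟨h1, ?_⟩
    refine Iff.trans ⟨fun h => ?_, subsingleton_ext_succ_of_quotSMulTop ha hreg.1 _⟩ (ih2.trans
      ((Submodule.quotOfListConsSMulTopEquivQuotSMulTopInner M a rs).congrRight
        (M := N)).toEquiv.subsingleton_congr.symm)
    have zero1 := AddCommGrpCat.isZero_of_iff_subsingleton.mpr (h1 rs.length (by simp))
    have zero2 := AddCommGrpCat.isZero_of_iff_subsingleton.mpr h
    exact AddCommGrpCat.subsingleton_of_isZero <| ShortComplex.Exact.isZero_of_both_zeros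
      (Ext.covariant_sequence_exact₃' N hreg.1.smulShortComplex_shortExact rs.length _ rfl)
      (zero1.eq_zero_of_src _) (zero2.eq_zero_of_tgt _)

/-- A weakly regular sequence in `I` modulo which some nonzero class is annihilated by `I` is at
least as long as every other weakly regular sequence in `I`. -/
theorem length_le_of_isWeaklyRegular_of_smul_mem {M : Type u} [AddCommGroup M] [Module A M]
    (I : Ideal A) {fs gs : List A} (hfs : ∀ a ∈ fs, a ∈ I) (hgs : ∀ a ∈ gs, a ∈ I)
    (hf : IsWeaklyRegular M fs) (hg : IsWeaklyRegular M gs) {u : M}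
    (hu : u ∉ (Ideal.ofList fs • ⊤ : Submodule A M))
    (hIu : ∀ a ∈ I, a • u ∈ (Ideal.ofList fs • ⊤ : Submodule A M)) :
    gs.length ≤ fs.length := by
  by_contra! hlt
  have hann : ∀ a ∈ I, a ∈ Module.annihilator A (ModuleCat.of A (A ⧸ I)) := by
    intro a ha
    exact (Ideal.annihilator_quotient (I := I)).symm ▸ ha
  have h := ((subsingleton_ext_of_isWeaklyRegular (ModuleCat.of A (A ⧸ I)) fs
    (fun a ha => hann a (hfs a ha)) (ModuleCat.of A M) hf).2).mp
    ((subsingleton_ext_of_isWeaklyRegular (ModuleCat.of A (A ⧸ I)) gs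
    (fun a ha => hann a (hgs a ha)) (ModuleCat.of A M) hg).1 _ hlt)
  let φ : A ⧸ I →ₗ[A] M ⧸ (Ideal.ofList fs • ⊤ : Submodule A M) :=
    Submodule.liftQ I (LinearMap.toSpanSingleton A _ (Submodule.Quotient.mk u)) fun a ha => by
      simpa [← Submodule.Quotient.mk_smul] using hIu a ha
  have h0 : φ = 0 := h.elim _ _
  have h1 : (1 : A) • (Submodule.Quotient.mk u : M ⧸ (Ideal.ofList fs • ⊤ : Submodule A M)) = 0 :=
    show φ (Submodule.Quotient.mk 1) = 0 by rw [h0]; rfl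
  exact hu ((Submodule.Quotient.mk_eq_zero _).mp (by rwa [one_smul] at h1))

/-- Weakly regular sequences restrict to linear retracts. -/
lemma isWeaklyRegular_of_retract {M N : Type*} [AddCommGroup M] [Module A M] [AddCommGroup N]
    [Module A N] (ι : N →ₗ[A] M) (π : M →ₗ[A] N) (h : π ∘ₗ ι = LinearMap.id) {rs : List A}
    (hM : IsWeaklyRegular M rs) : IsWeaklyRegular N rs := by
  refine ⟨fun i hi => ?_⟩
  have hr := hM.regular_mod_prev i hi
  set J := Ideal.ofList (rs.take i)
  intro x y hxy
  let ι' := Submodule.mapQ _ _ ι (Submodule.smul_top_le_comap_smul_top J ι)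
  let π' := Submodule.mapQ _ _ π (Submodule.smul_top_le_comap_smul_top J π)
  have hπ : ∀ z, π' (ι' z) = z := by
    intro z
    obtain ⟨z, rfl⟩ := Submodule.Quotient.mk_surjective _ z
    simpa [π', ι'] using congrArg _ (LinearMap.congr_fun h z)
  have h1 : ι' x = ι' y := hr (by simpa using congrArg ι' hxy)
  rw [← hπ x, h1, hπ]

end Rees

section MaximalSequence
open RingTheory.Sequence

variable {A B : Type*} [CommRing A] [CommRing B] [Algebra A B] [IsNoetherianRing B]

/-- Over a Noetherian `A`-algebra `B`, an ideal `I` of `A` either contains a nonzerodivisor on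
`B ⧸ JB`, or annihilates a nonzero element of it. -/
lemma exists_isSMulRegular_or_exists_smul_mem (I J : Ideal A) :
    (∃ a ∈ I, IsSMulRegular (B ⧸ (J • ⊤ : Submodule A B)) a) ∨
      ∃ u : B, u ∉ (J • ⊤ : Submodule A B) ∧ ∀ a ∈ I, a • u ∈ (J • ⊤ : Submodule A B) := by
  set JB : Ideal B := J.map (algebraMap A B)
  have hmem : ∀ x : B, x ∈ (J • ⊤ : Submodule A B) ↔ x ∈ JB := by
    intro x
    rw [Ideal.smul_top_eq_map]
    rfl
  have hfin := associatedPrimes.finite B (B ⧸ JB)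
  by_cases hI : (I : Set A) ⊆
      ⋃ p ∈ associatedPrimes B (B ⧸ JB), (Ideal.comap (algebraMap A B) p : Set A)
  · right
    obtain ⟨p, hp, hIp⟩ := (Ideal.subset_union_prime_finite hfin ⊤ ⊤
      (fun p hp _ _ => have := hp.isPrime; Ideal.comap_isPrime _ p)).mp hI
    obtain ⟨hprime, x, hx⟩ := isAssociatedPrime_iff.mp hp
    obtain ⟨u, rfl⟩ := Ideal.Quotient.mk_surjective x
    have key : ∀ b : B, b ∈ p ↔ b * u ∈ JB := by
      intro b
      rw [hx, Submodule.mem_colon_singleton, Submodule.mem_bot, ← Ideal.Quotient.eq_zero_iff_mem]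
      rfl
    refine ⟨u, fun hu => hprime.ne_top ((Ideal.eq_top_iff_one p).mpr ?_), fun a ha => ?_⟩
    · rw [key, one_mul]
      exact (hmem u).mp hu
    · rw [hmem, Algebra.smul_def]
      exact (key _).mp (hIp ha)
  · left
    obtain ⟨a, ha, hna⟩ := Set.not_subset.mp hI
    refine ⟨a, ha, ?_⟩
    rw [isSMulRegular_iff_right_eq_zero_of_smul]
    intro x hax
    obtain ⟨u, rfl⟩ := Submodule.Quotient.mk_surjective _ x
    rw [← Submodule.Quotient.mk_smul, Submodule.Quotient.mk_eq_zero, hmem, Algebra.smul_def] at hax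
    rw [Submodule.Quotient.mk_eq_zero, hmem]
    by_contra hu
    have hz : algebraMap A B a ∈ {b : B | ∃ y : B ⧸ JB, y ≠ 0 ∧ b • y = 0} :=
      ⟨Ideal.Quotient.mk JB u, fun h => hu (Ideal.Quotient.eq_zero_iff_mem.mp h),
        Ideal.Quotient.eq_zero_iff_mem.mpr hax⟩
    rw [← biUnion_associatedPrimes_eq_zero_divisors] at hz
    simp only [Set.mem_iUnion] at hz hna
    obtain ⟨p, hp, h⟩ := hz
    exact hna ⟨p, hp, h⟩

/-- If the lengths of `B`-weakly regular sequences in `I` are bounded, some such sequence is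
maximal in the sense that `I` annihilates a nonzero element modulo it. -/
lemma exists_isWeaklyRegular_of_bounded (I : Ideal A) (n : ℕ)
    (hbd : ∀ fs : List A, (∀ a ∈ fs, a ∈ I) → IsWeaklyRegular B fs → fs.length ≤ n) :
    ∃ fs : List A, (∀ a ∈ fs, a ∈ I) ∧ IsWeaklyRegular B fs ∧
      ∃ u : B, u ∉ (Ideal.ofList fs • ⊤ : Submodule A B) ∧
        ∀ a ∈ I, a • u ∈ (Ideal.ofList fs • ⊤ : Submodule A B) := by
  by_contra! hcon
  have hlen : ∀ m : ℕ, ∃ fs : List A, fs.length = m ∧ (∀ a ∈ fs, a ∈ I) ∧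
      IsWeaklyRegular B fs := by
    intro m
    induction m with
    | zero => exact ⟨[], rfl, by simp, .nil A B⟩
    | succ m ih =>
      obtain ⟨fs, hfs, hI, hreg⟩ := ih
      obtain ⟨a, ha, hareg⟩ | ⟨u, hu, hIu⟩ :=
        exists_isSMulRegular_or_exists_smul_mem (B := B) I (Ideal.ofList fs)
      · refine ⟨fs ++ [a], by simp [hfs], ?_, ?_⟩
        · intro b hb
          rcases List.mem_append.mp hb with hb | hb
          · exact hI b hb
          · rwa [List.mem_singleton.mp hb]
        · rw [isWeaklyRegular_append_iff, isWeaklyRegular_singleton_iff]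
          exact ⟨hreg, hareg⟩
      · obtain ⟨a, ha, hau⟩ := hcon fs hI hreg u hu
        exact absurd (hIu a ha) hau
  obtain ⟨fs, hfs, hI, hreg⟩ := hlen (n + 1)
  have := hbd fs hI hreg
  omega

end MaximalSequence

section CosetProjection

variable {K : Type*} [Field K] {r s : ℕ} (S : AddSubmonoid (Fin r → ℤ)) (σ : Fin s → Fin r → ℤ)

/-- The residue class modulo `σ(ℤ^r)` of an exponent vector. -/
def expClass : (Fin s → ℕ) →+ classGroup σ where
  toFun t := QuotientAddGroup.mk' (formsRange σ) (fun i => (t i : ℤ))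
  map_zero' := (QuotientAddGroup.eq_zero_iff _).mpr (by
    convert (formsRange σ).zero_mem
    rfl)
  map_add' a b := by
    rw [← map_add]
    congr 1

variable {S σ}

lemma coe_stdExp (hrep : ∀ x : Fin r → ℤ, x ∈ S ↔ ∀ i, 0 ≤ lin (σ i) x) {x : Fin r → ℤ}
    (hx : x ∈ S) (i : Fin s) : (stdExp σ x i : ℤ) = lin (σ i) x :=
  Int.toNat_of_nonneg ((hrep x).mp hx i)

lemma stdExp_add (hrep : ∀ x : Fin r → ℤ, x ∈ S ↔ ∀ i, 0 ≤ lin (σ i) x) {x y : Fin r → ℤ}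
    (hx : x ∈ S) (hy : y ∈ S) : stdExp σ (x + y) = stdExp σ x + stdExp σ y := by
  funext i
  have h := lin_add (σ i) x y
  rw [← coe_stdExp hrep (S.add_mem hx hy), ← coe_stdExp hrep hx, ← coe_stdExp hrep hy] at h
  exact_mod_cast h

lemma expClass_stdExp (hrep : ∀ x : Fin r → ℤ, x ∈ S ↔ ∀ i, 0 ≤ lin (σ i) x) {x : Fin r → ℤ}
    (hx : x ∈ S) : expClass σ (stdExp σ x) = 0 :=
  (QuotientAddGroup.eq_zero_iff _).mpr ⟨x, funext fun i => (coe_stdExp hrep hx i).symm⟩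

open Classical in
/-- The projection of `P` onto the span of the monomials of residue class `d`. -/
def classPart (d : classGroup σ) :
    AddMonoidAlgebra K (Fin s → ℕ) →+ AddMonoidAlgebra K (Fin s → ℕ) where
  toFun f := .ofCoeff (f.coeff.filter (fun t => expClass σ t = d))
  map_zero' := congrArg AddMonoidAlgebra.ofCoeff (Finsupp.filter_zero _)
  map_add' f g := by ext; simp [Finsupp.filter_add]

open Classical in
lemma coeff_classPart (d : classGroup σ) (f : AddMonoidAlgebra K (Fin s → ℕ)) (t : Fin s → ℕ) :
    (classPart d f).coeff t = if expClass σ t = d then f.coeff t else 0 :=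
  Finsupp.filter_apply _ _ _

open Classical in
lemma classPart_single (d : classGroup σ) (t : Fin s → ℕ) (k : K) :
    classPart d (.single t k) = if expClass σ t = d then .single t k else 0 := by
  ext u
  rw [coeff_classPart]
  by_cases h : t = u
  · subst h
    split_ifs <;> simp
  · split_ifs <;> simp [h]

lemma classPart_single_mul (d : classGroup σ) {t : Fin s → ℕ} (ht : expClass σ t = 0) (k : K)
    (f : AddMonoidAlgebra K (Fin s → ℕ)) :
    classPart d (.single t k * f) = .single t k * classPart d f := by
  induction f using AddMonoidAlgebra.induction_linear with
  | zero => simp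
  | add f g hf hg => rw [mul_add, map_add, map_add, mul_add, hf, hg]
  | single u l =>
    rw [AddMonoidAlgebra.single_mul_single, classPart_single, classPart_single, map_add, ht,
      zero_add]
    split_ifs <;> simp [AddMonoidAlgebra.single_mul_single]

lemma classPart_mul (hrep : ∀ x : Fin r → ℤ, x ∈ S ↔ ∀ i, 0 ≤ lin (σ i) x) (d : classGroup σ)
    {a : AddMonoidAlgebra K (Fin s → ℕ)} (ha : a ∈ stdRingP K S σ)
    (f : AddMonoidAlgebra K (Fin s → ℕ)) : classPart d (a * f) = a * classPart d f := by
  induction ha using Algebra.adjoin_induction generalizing f with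
  | mem a ha =>
    obtain ⟨x, hx, rfl⟩ := ha
    exact classPart_single_mul d (expClass_stdExp hrep hx) 1 f
  | algebraMap k => exact classPart_single_mul d (map_zero _) k f
  | add a b _ _ ha hb => rw [add_mul, map_add, ha, hb, add_mul]
  | mul a b _ _ ha hb => rw [mul_assoc, ha, hb, mul_assoc]

open Classical in
lemma sum_classPart (f : AddMonoidAlgebra K (Fin s → ℕ)) :
    ∑ d ∈ f.coeff.support.image (expClass σ), classPart d f = f := by
  ext t
  rw [AddMonoidAlgebra.coeff_sum, Finsupp.finsetSum_apply]
  simp only [coeff_classPart]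
  rw [Finset.sum_ite_eq]
  split_ifs with h
  · rfl
  · by_contra h0
    exact h (Finset.mem_image_of_mem _ (Finsupp.mem_support_iff.mpr (Ne.symm h0)))

lemma classPart_mem (c : classGroup σ) (f : AddMonoidAlgebra K (Fin s → ℕ)) :
    classPart (-c) f ∈ cosetModuleP K S σ c := by
  induction f using AddMonoidAlgebra.induction_linear with
  | zero => simp
  | add f g hf hg => rw [map_add]; exact add_mem hf hg
  | single t k =>
    rw [classPart_single]
    split_ifs with h
    · have : (AddMonoidAlgebra.single t k : AddMonoidAlgebra K (Fin s → ℕ)) = k • monoN K t := by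
        simp [monoN]
      rw [this]
      exact Submodule.smul_of_tower_mem _ k (Submodule.subset_span ⟨t, h, rfl⟩)
    · exact zero_mem _

lemma classPart_eq_self (hrep : ∀ x : Fin r → ℤ, x ∈ S ↔ ∀ i, 0 ≤ lin (σ i) x) (c : classGroup σ)
    {f : AddMonoidAlgebra K (Fin s → ℕ)} (hf : f ∈ cosetModuleP K S σ c) :
    classPart (-c) f = f := by
  induction hf using Submodule.span_induction with
  | mem f hf =>
    obtain ⟨t, ht, rfl⟩ := hf
    exact (classPart_single _ _ _).trans (if_pos ht)
  | zero => exact map_zero _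
  | add f g _ _ hf hg => rw [map_add, hf, hg]
  | smul a f _ hf =>
    rw [Algebra.smul_def]
    exact (classPart_mul hrep _ a.2 f).trans (by rw [hf]; rfl)

/-- The `R`-linear projection `P → M_c`. -/
def cosetProj (hrep : ∀ x : Fin r → ℤ, x ∈ S ↔ ∀ i, 0 ≤ lin (σ i) x) (c : classGroup σ) :
    AddMonoidAlgebra K (Fin s → ℕ) →ₗ[stdRingP K S σ] cosetModuleP K S σ c where
  toFun f := ⟨classPart (-c) f, classPart_mem c f⟩
  map_add' f g := Subtype.ext (map_add _ f g)
  map_smul' a f := Subtype.ext (classPart_mul hrep (-c) a.2 f)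

lemma cosetProj_comp_subtype (hrep : ∀ x : Fin r → ℤ, x ∈ S ↔ ∀ i, 0 ≤ lin (σ i) x)
    (c : classGroup σ) :
    cosetProj (K := K) hrep c ∘ₗ (cosetModuleP K S σ c).subtype = LinearMap.id :=
  LinearMap.ext fun f => Subtype.ext (classPart_eq_self hrep c f.2)

/-- An element of `P` lies in `JP` as soon as all its components lie in `J M_c`. -/
lemma mem_smul_top_of_cosetProj (hrep : ∀ x : Fin r → ℤ, x ∈ S ↔ ∀ i, 0 ≤ lin (σ i) x)
    (J : Ideal (stdRingP K S σ)) {u : AddMonoidAlgebra K (Fin s → ℕ)}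
    (hu : ∀ c, cosetProj hrep c u ∈ (J • ⊤ : Submodule (stdRingP K S σ) (cosetModuleP K S σ c))) :
    u ∈ (J • ⊤ : Submodule (stdRingP K S σ) (AddMonoidAlgebra K (Fin s → ℕ))) := by
  classical
  rw [← sum_classPart (σ := σ) u]
  refine Submodule.sum_mem _ fun d _ => ?_
  have h := Submodule.smul_top_le_comap_smul_top J (cosetModuleP K S σ (-d)).subtype (hu (-d))
  simpa [cosetProj] using h

end CosetProjection

section IrrelevantIdeal

variable {K : Type*} [Field K] {r s : ℕ} {S : AddSubmonoid (Fin r → ℤ)} {σ : Fin s → Fin r → ℤ}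

lemma eq_zero_of_lin_eq_zero (hSpos : ∀ x ∈ S, -x ∈ S → x = 0)
    (hrep : ∀ x : Fin r → ℤ, x ∈ S ↔ ∀ i, 0 ≤ lin (σ i) x) {x : Fin r → ℤ}
    (hx : ∀ i, lin (σ i) x = 0) : x = 0 := by
  refine hSpos x ((hrep x).mpr fun i => (hx i).ge) ((hrep _).mpr fun i => ?_)
  have h := lin_add (σ i) x (-x)
  rw [add_neg_cancel, lin_zero, hx i, zero_add] at h
  exact h.le

lemma stdExp_injOn (hSpos : ∀ x ∈ S, -x ∈ S → x = 0)
    (hrep : ∀ x : Fin r → ℤ, x ∈ S ↔ ∀ i, 0 ≤ lin (σ i) x) {x y : Fin r → ℤ}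
    (hx : x ∈ S) (hy : y ∈ S) (h : stdExp σ x = stdExp σ y) : x = y := by
  refine sub_eq_zero.mp (eq_zero_of_lin_eq_zero (σ := σ) hSpos hrep fun i => ?_)
  have h1 := lin_add (σ i) (x - y) y
  rw [sub_add_cancel, ← coe_stdExp hrep hx, ← coe_stdExp hrep hy, h] at h1
  linarith

lemma coe_mem_extIdealP {f : stdRingP K S σ} (hf : f ∈ irrIdealP K S σ) :
    (f : AddMonoidAlgebra K (Fin s → ℕ)) ∈ extIdealP K S σ := by
  have h : irrIdealP K S σ ≤ (extIdealP K S σ).comap (stdRingP K S σ).val.toRingHom :=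
    Ideal.span_le.mpr fun g hg => Ideal.subset_span hg
  exact h hf

lemma extIdealP_eq_span_image : extIdealP K S σ =
    Ideal.span (AddMonoidAlgebra.of' K (Fin s → ℕ) '' (stdExp σ '' {x | x ∈ S ∧ x ≠ 0})) := by
  refine congrArg Ideal.span (Set.ext fun f => ⟨?_, ?_⟩)
  · rintro ⟨x, hx, hx0, rfl⟩
    exact ⟨_, ⟨x, ⟨hx, hx0⟩, rfl⟩, rfl⟩
  · rintro ⟨_, ⟨x, ⟨hx, hx0⟩, rfl⟩, rfl⟩
    exact ⟨x, hx, hx0, rfl⟩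

lemma extIdealP_ne_top (hSpos : ∀ x ∈ S, -x ∈ S → x = 0)
    (hrep : ∀ x : Fin r → ℤ, x ∈ S ↔ ∀ i, 0 ≤ lin (σ i) x) : extIdealP K S σ ≠ ⊤ := by
  rw [Ne, Ideal.eq_top_iff_one, extIdealP_eq_span_image,
    AddMonoidAlgebra.mem_ideal_span_of'_image]
  intro h
  obtain ⟨_, ⟨x, ⟨hx, hx0⟩, rfl⟩, d, hd⟩ := h 0 (by
    rw [AddMonoidAlgebra.one_def, AddMonoidAlgebra.coeff_single]
    simp)
  refine hx0 (eq_zero_of_lin_eq_zero (σ := σ) hSpos hrep fun i => ?_)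
  have hi : (0 : ℕ) = d i + stdExp σ x i := congrFun hd i
  rw [← coe_stdExp hrep hx]
  omega

/-- Every sequence in a proper ideal of a ring that is weakly regular on the ring is regular. -/
lemma isRegular_of_forall_mem {B : Type*} [CommRing B] {I : Ideal B} (hI : I ≠ ⊤) {rs : List B}
    (hmem : ∀ b ∈ rs, b ∈ I) (h : RingTheory.Sequence.IsWeaklyRegular B rs) :
    RingTheory.Sequence.IsRegular B rs := by
  refine ⟨h, fun htop => hI (top_le_iff.mp ?_)⟩
  rw [smul_eq_mul, Ideal.mul_top] at htop
  rw [htop]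
  exact Ideal.span_le.mpr hmem

lemma exists_lin_pos (hSgp : ∀ x : Fin r → ℤ, ∃ a ∈ S, ∃ b ∈ S, x = a - b)
    (hrep : ∀ x : Fin r → ℤ, x ∈ S ↔ ∀ i, 0 ≤ lin (σ i) x)
    (hprim : ∀ i, Finset.univ.gcd (σ i) = 1) (i : Fin s) : ∃ x ∈ S, 0 < lin (σ i) x := by
  obtain ⟨k, hk⟩ : ∃ k, σ i k ≠ 0 := by
    by_contra! h
    have := Finset.gcd_eq_zero_iff.mpr fun k (_ : k ∈ Finset.univ) => h k
    rw [hprim i] at this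
    exact one_ne_zero this
  obtain ⟨a, ha, b, hb, hab⟩ := hSgp (Pi.single k 1)
  have h1 : lin (σ i) (Pi.single k 1) = σ i k := by simp [lin, Pi.single_apply]
  have h2 := lin_add (σ i) (Pi.single k 1) b
  rw [h1, hab, sub_add_cancel] at h2
  have hb0 := (hrep b).mp hb i
  rcases hb0.lt_or_eq with h | h
  · exact ⟨b, hb, h⟩
  · refine ⟨a, ha, lt_of_le_of_ne ((hrep a).mp ha i) fun h0 => hk ?_⟩
    linarith

lemma lin_nsmul (f x : Fin r → ℤ) (n : ℕ) : lin f (n • x) = n * lin f x := by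
  simp [lin, Finset.mul_sum, mul_left_comm]

/-- There is an element of `S` in the interior of the cone. -/
lemma exists_forall_lin_pos (hSgp : ∀ x : Fin r → ℤ, ∃ a ∈ S, ∃ b ∈ S, x = a - b)
    (hrep : ∀ x : Fin r → ℤ, x ∈ S ↔ ∀ i, 0 ≤ lin (σ i) x)
    (hprim : ∀ i, Finset.univ.gcd (σ i) = 1) : ∃ x ∈ S, ∀ i, 0 < lin (σ i) x := by
  choose z hzS hz using exists_lin_pos hSgp hrep hprim
  have hsum : ∀ i, lin (σ i) (∑ j, z j) = ∑ j, lin (σ i) (z j) := fun i =>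
    map_sum (⟨⟨lin (σ i), lin_zero _⟩, lin_add _⟩ : (Fin r → ℤ) →+ ℤ) z _
  refine ⟨∑ j, z j, sum_mem fun j _ => hzS j, fun i => ?_⟩
  rw [hsum]
  exact Finset.sum_pos' (fun j _ => (hrep _).mp (hzS j) i) ⟨i, Finset.mem_univ _, hz i⟩

lemma exists_expClass_eq (hSgp : ∀ x : Fin r → ℤ, ∃ a ∈ S, ∃ b ∈ S, x = a - b)
    (hrep : ∀ x : Fin r → ℤ, x ∈ S ↔ ∀ i, 0 ≤ lin (σ i) x)
    (hprim : ∀ i, Finset.univ.gcd (σ i) = 1) (d : classGroup σ) :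
    ∃ t : Fin s → ℕ, expClass σ t = d := by
  obtain ⟨v, rfl⟩ := QuotientAddGroup.mk'_surjective _ d
  obtain ⟨w, hwS, hw⟩ := exists_forall_lin_pos hSgp hrep hprim
  set N : ℕ := ∑ i, (v i).natAbs
  have hN : ∀ i, 0 ≤ v i + lin (σ i) (N • w) := by
    intro i
    have h1 : (v i).natAbs ≤ N :=
      Finset.single_le_sum (f := fun i => (v i).natAbs) (fun _ _ => Nat.zero_le _)
        (Finset.mem_univ i)
    rw [lin_nsmul]
    nlinarith [hw i, abs_le.mp (Int.abs_eq_natAbs (v i)).le, (Int.ofNat_le.mpr h1)]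
  refine ⟨fun i => (v i + lin (σ i) (N • w)).toNat, ?_⟩
  refine (QuotientAddGroup.mk'_eq_mk' _).mpr ⟨-formsHom σ (N • w),
    neg_mem ⟨N • w, rfl⟩, funext fun i => ?_⟩
  simp only [Pi.add_apply, Int.toNat_of_nonneg (hN i)]
  exact add_neg_cancel_right _ _

instance isNoetherianRing_addMonoidAlgebra_pi : IsNoetherianRing (AddMonoidAlgebra K (Fin s → ℕ)) :=
  Algebra.FiniteType.isNoetherianRing K _

/-- `𝔪 M_c ≠ M_c`. -/
lemma irrIdealP_smul_top_ne_top (hSpos : ∀ x ∈ S, -x ∈ S → x = 0)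
    (hSgp : ∀ x : Fin r → ℤ, ∃ a ∈ S, ∃ b ∈ S, x = a - b)
    (hrep : ∀ x : Fin r → ℤ, x ∈ S ↔ ∀ i, 0 ≤ lin (σ i) x)
    (hprim : ∀ i, Finset.univ.gcd (σ i) = 1) (c : classGroup σ) :
    (irrIdealP K S σ • ⊤ : Submodule (stdRingP K S σ) (cosetModuleP K S σ c)) ≠ ⊤ := by
  intro htop
  have hpow : ∀ (n : ℕ) (f : cosetModuleP K S σ c),
      (f : AddMonoidAlgebra K (Fin s → ℕ)) ∈ extIdealP K S σ ^ n := by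
    intro n
    induction n with
    | zero => simp
    | succ n ih =>
      intro f
      have hf : f ∈ (irrIdealP K S σ • ⊤ : Submodule (stdRingP K S σ) (cosetModuleP K S σ c)) :=
        by rw [htop]; exact Submodule.mem_top
      induction hf using Submodule.smul_induction_on' with
      | smul a ha m _ =>
        rw [pow_succ']
        exact Ideal.mul_mem_mul (coe_mem_extIdealP ha) (ih m)
      | add x _ y _ hx hy => exact add_mem hx hy
  obtain ⟨t, ht⟩ := exists_expClass_eq hSgp hrep hprim (-c)
  have hmem : monoN K t ∈ cosetModuleP K S σ c := Submodule.subset_span ⟨t, ht, rfl⟩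
  have h0 : monoN K t ∈ ⨅ n, extIdealP K S σ ^ n :=
    Ideal.mem_iInf.mpr fun n => hpow n ⟨_, hmem⟩
  rw [Ideal.iInf_pow_eq_bot_of_isDomain _ (extIdealP_ne_top hSpos hrep), Ideal.mem_bot] at h0
  exact one_ne_zero (AddMonoidAlgebra.single_eq_zero.mp h0)

end IrrelevantIdeal

section RegularMonomials

variable {G : Type*} [AddCommGroup G] (S : AddSubmonoid G) (x : ℕ → G)

/-- The elements of `G` lying in the `S`-ideal generated by `x l`, `l ∈ T`. -/
def genIdeal (T : Set ℕ) : Set G := {y | ∃ l ∈ T, y - x l ∈ S}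

/-- `x k` is a nonzerodivisor on `S` modulo the `S`-ideal generated by `x l`, `l ∈ T`. -/
def IsRegularMod (T : Set ℕ) (k : ℕ) : Prop :=
  ∀ y ∈ S, y + x k ∈ genIdeal S x T → y ∈ genIdeal S x T

variable {S x} {T : Set ℕ} {a b : ℕ}

lemma add_mem_genIdeal {y w : G} (hw : w ∈ S) (hy : y ∈ genIdeal S x T) :
    w + y ∈ genIdeal S x T := by
  obtain ⟨l, hl, h⟩ := hy
  exact ⟨l, hl, by rw [add_sub_assoc]; exact S.add_mem hw h⟩

lemma mem_genIdeal_insert {y : G} :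
    y ∈ genIdeal S x (insert a T) ↔ y - x a ∈ S ∨ y ∈ genIdeal S x T := by
  simp [genIdeal]

lemma IsRegularMod.of_insert (deg : G →+ ℤ) (hdeg : ∀ y ∈ S, 0 ≤ deg y) (ha0 : 0 < deg (x a))
    (ha : x a ∈ S) (hb : x b ∈ S) (h1 : IsRegularMod S x T a)
    (h2 : IsRegularMod S x (insert a T) b) : IsRegularMod S x T b := by
  have key : ∀ (n : ℕ), ∀ y ∈ S, (deg y).toNat < n → y + x b ∈ genIdeal S x T →
      y ∈ genIdeal S x T := by
    intro n
    induction n with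
    | zero => intro y _ hn; omega
    | succ n ih =>
      intro y hy hn hyb
      rcases mem_genIdeal_insert.mp (h2 y hy (mem_genIdeal_insert.mpr (Or.inr hyb))) with h | h
      · have hlt : (deg (y - x a)).toNat < n := by
          have := hdeg _ h
          rw [map_sub] at this ⊢
          omega
        have h3 : y - x a + x b ∈ genIdeal S x T :=
          h1 _ (S.add_mem h hb) (by convert hyb using 1; abel)
        have h4 := add_mem_genIdeal ha (ih _ h hlt h3)
        rwa [add_sub_cancel] at h4
      · exact h
  exact fun y hy => key _ y hy (Nat.lt_succ_self _)

lemma IsRegularMod.exchange (hb : x b ∈ S) (h1 : IsRegularMod S x T a)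
    (h2 : IsRegularMod S x (insert a T) b) : IsRegularMod S x (insert b T) a := by
  intro y hy hya
  rw [mem_genIdeal_insert] at hya ⊢
  rcases hya with hz | h
  · have h3 : y + x a - x b ∈ genIdeal S x (insert a T) := by
      refine h2 _ hz (mem_genIdeal_insert.mpr (Or.inl ?_))
      convert hy using 1
      abel
    rcases mem_genIdeal_insert.mp h3 with h | h
    · left
      convert h using 1
      abel
    · right
      refine h1 y hy ?_
      have := add_mem_genIdeal hb h
      rwa [add_sub_cancel] at this
  · exact Or.inr (h1 y hy h)

lemma insert_setOf_lt (m : ℕ) : insert m {l | l < m} = {l | l < m + 1} := by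
  ext l
  simp only [Set.mem_insert_iff, Set.mem_ofPred_eq]
  omega

/-- In a regular sequence of monomials, any later monomial is regular modulo any earlier one. -/
lemma isRegularMod_singleton {n : ℕ} (deg : G →+ ℤ) (hdeg : ∀ y ∈ S, 0 ≤ deg y)
    (hx0 : ∀ k < n, 0 < deg (x k)) (hx : ∀ k < n, x k ∈ S)
    (h : ∀ k < n, IsRegularMod S x {l | l < k} k) {j k : ℕ} (hjk : j < k) (hk : k < n) :
    IsRegularMod S x {j} k := by
  have hinit : ∀ k < n, ∀ m ≤ k, IsRegularMod S x {l | l < m} k := by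
    intro k hk m hm
    induction hm using Nat.decreasingInduction with
    | self => exact h k hk
    | of_succ m hm ih =>
      refine .of_insert deg hdeg (hx0 m (hm.trans hk)) (hx m (hm.trans hk)) (hx k hk)
        (h m (hm.trans hk)) ?_
      rwa [insert_setOf_lt]
  have hmain : ∀ m ≤ j, IsRegularMod S x (insert j {l | l < m}) k := by
    intro m hm
    induction hm using Nat.decreasingInduction with
    | self =>
      rw [insert_setOf_lt]
      exact hinit k hk _ hjk
    | of_succ m hm ih =>
      have hj := hjk.trans hk
      have hmn := hm.trans hj
      refine .of_insert deg hdeg (hx0 m hmn) (hx m hmn) (hx k hk)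
        (.exchange (hx j hj) (h m hmn) ?_) ?_
      · rw [insert_setOf_lt]
        exact hinit j hj _ hm
      · rwa [Set.insert_comm, insert_setOf_lt]
  simpa using hmain 0 (Nat.zero_le _)

lemma IsRegularMod.of_add_nsmul (hb : x b ∈ S) (h : IsRegularMod S x T b) (m : ℕ) {y : G}
    (hy : y ∈ S) (hm : y + m • x b ∈ genIdeal S x T) : y ∈ genIdeal S x T := by
  induction m with
  | zero => simpa using hm
  | succ m ih =>
    refine ih (h _ (S.add_mem hy (S.nsmul_mem hb m)) ?_)
    rwa [succ_nsmul, ← add_assoc] at hm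

end RegularMonomials

section DisjointSupports

variable {r s : ℕ} {S : AddSubmonoid (Fin r → ℤ)} {σ : Fin s → Fin r → ℤ}

/-- Each facet of the cone has an element of `S` in its relative interior. -/
lemma exists_lin_eq_zero_forall_lin_pos
    (hSgp : ∀ x : Fin r → ℤ, ∃ a ∈ S, ∃ b ∈ S, x = a - b)
    (hrep : ∀ x : Fin r → ℤ, x ∈ S ↔ ∀ i, 0 ≤ lin (σ i) x)
    (hirr : ∀ j, ∃ x : Fin r → ℤ, lin (σ j) x < 0 ∧ ∀ i, i ≠ j → 0 ≤ lin (σ i) x)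
    (hprim : ∀ i, Finset.univ.gcd (σ i) = 1) (j : Fin s) :
    ∃ z ∈ S, lin (σ j) z = 0 ∧ ∀ i, i ≠ j → 0 < lin (σ i) z := by
  obtain ⟨w, -, hw⟩ := exists_forall_lin_pos hSgp hrep hprim
  obtain ⟨y, hyj, hy⟩ := hirr j
  obtain ⟨q, hq⟩ := Int.eq_ofNat_of_zero_le (neg_nonneg.mpr hyj.le)
  obtain ⟨p, hp⟩ := Int.eq_ofNat_of_zero_le (hw j).le
  have hlin : ∀ i, lin (σ i) (q • w + p • y) = q * lin (σ i) w + p * lin (σ i) y := fun i => by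
    rw [lin_add, lin_nsmul, lin_nsmul]
  have hj : lin (σ j) (q • w + p • y) = 0 := by
    rw [hlin, ← hq, ← hp]
    ring
  have hi : ∀ i, i ≠ j → 0 < lin (σ i) (q • w + p • y) := by
    intro i hij
    rw [hlin, ← hq, ← hp]
    have := mul_pos (neg_pos.mpr hyj) (hw i)
    have := mul_nonneg (hw j).le (hy i hij)
    linarith
  refine ⟨q • w + p • y, (hrep _).mpr fun i => ?_, hj, hi⟩
  rcases eq_or_ne i j with rfl | hij
  · exact hj.ge
  · exact (hi i hij).le

lemma stdExp_eq_zero_or_of_isRegularMod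
    (hSgp : ∀ x : Fin r → ℤ, ∃ a ∈ S, ∃ b ∈ S, x = a - b)
    (hrep : ∀ x : Fin r → ℤ, x ∈ S ↔ ∀ i, 0 ≤ lin (σ i) x)
    (hirr : ∀ j, ∃ x : Fin r → ℤ, lin (σ j) x < 0 ∧ ∀ i, i ≠ j → 0 ≤ lin (σ i) x)
    (hprim : ∀ i, Finset.univ.gcd (σ i) = 1) {x : ℕ → Fin r → ℤ} {j k : ℕ}
    (hj : x j ∈ S) (hk : x k ∈ S) (h : IsRegularMod S x {j} k) (i : Fin s) :
    stdExp σ (x j) i = 0 ∨ stdExp σ (x k) i = 0 := by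
  by_contra! hcon
  obtain ⟨hji, hki⟩ := hcon
  obtain ⟨z, hzS, hz, hzpos⟩ := exists_lin_eq_zero_forall_lin_pos hSgp hrep hirr hprim i
  set N := ∑ l, stdExp σ (x j) l
  have hlin : ∀ l (y : Fin r → ℤ), lin (σ l) (y - x j) = lin (σ l) y - stdExp σ (x j) l := by
    intro l y
    rw [coe_stdExp hrep hj, eq_sub_iff_add_eq, ← lin_add, sub_add_cancel]
  have hmem : N • z + stdExp σ (x j) i • x k ∈ genIdeal S x {j} := by
    refine ⟨j, rfl, (hrep _).mpr fun l => ?_⟩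
    rw [hlin l, lin_add, lin_nsmul, lin_nsmul, ← coe_stdExp hrep hk]
    rcases eq_or_ne l i with rfl | hl
    · rw [hz]
      have : 1 ≤ (stdExp σ (x k) l : ℤ) := by omega
      nlinarith
    · have h1 : stdExp σ (x j) l ≤ N := Finset.single_le_sum (fun _ _ => Nat.zero_le _)
        (Finset.mem_univ l)
      have h2 := hzpos l hl
      have h3 : (0 : ℤ) ≤ stdExp σ (x j) i * stdExp σ (x k) l := by positivity
      have h4 : (stdExp σ (x j) l : ℤ) ≤ N := by exact_mod_cast h1
      nlinarith
  obtain ⟨l, rfl, hl⟩ := h.of_add_nsmul hk _ (S.nsmul_mem hzS N) hmem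
  have h0 := (hrep _).mp hl i
  rw [hlin i, lin_nsmul, hz] at h0
  omega

variable {K : Type*} [Field K]

open RingTheory.Sequence

/-- Monomials of `P` with pairwise disjoint supports form a weakly regular sequence. -/
lemma isWeaklyRegular_of_disjoint_supports (rs : List (AddMonoidAlgebra K (Fin s → ℕ)))
    (t : ℕ → Fin s → ℕ) (hrs : ∀ k (hk : k < rs.length), rs[k] = monoN K (t k))
    (ht : ∀ j k, j < k → k < rs.length → ∀ i, t j i = 0 ∨ t k i = 0) :
    IsWeaklyRegular (AddMonoidAlgebra K (Fin s → ℕ)) rs := by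
  refine ⟨fun k hk => ?_⟩
  have hspan : Ideal.ofList (rs.take k) =
      Ideal.span (AddMonoidAlgebra.of' K (Fin s → ℕ) '' (t '' {l | l < k})) := by
    refine congrArg Ideal.span (Set.ext fun f => ?_)
    simp only [Set.mem_ofPred_eq, List.mem_take_iff_getElem, Set.mem_image,
      exists_exists_and_eq_and]
    constructor
    · rintro ⟨l, hl, rfl⟩
      exact ⟨l, by omega, (hrs l _).symm⟩
    · rintro ⟨l, hl, rfl⟩
      exact ⟨l, by omega, hrs l _⟩
  rw [isSMulRegular_quotient_iff_mem_of_smul_mem]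
  intro f hf
  rw [smul_eq_mul, Ideal.mul_top, hspan, AddMonoidAlgebra.mem_ideal_span_of'_image] at hf ⊢
  intro u hu
  obtain ⟨_, ⟨l, hl, rfl⟩, d, hd⟩ := hf (t k + u) (by
    rw [hrs k hk, smul_eq_mul, monoN, Finsupp.mem_support_iff,
      AddMonoidAlgebra.coeff_single_mul_add, one_mul]
    exact Finsupp.mem_support_iff.mp hu)
  refine ⟨_, ⟨l, hl, rfl⟩, u - t l, funext fun i => ?_⟩
  have h1 : t k i + u i = d i + t l i := congrFun hd i
  have h2 := ht l k hl hk i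
  simp only [Pi.add_apply, Pi.sub_apply]
  omega

lemma exists_eq_stdExp_of_mem_support
    (hrep : ∀ x : Fin r → ℤ, x ∈ S ↔ ∀ i, 0 ≤ lin (σ i) x)
    {f : AddMonoidAlgebra K (Fin s → ℕ)} (hf : f ∈ stdRingP K S σ) :
    ∀ t ∈ f.coeff.support, ∃ w ∈ S, t = stdExp σ w := by
  classical
  induction hf using Algebra.adjoin_induction with
  | mem f hf =>
    obtain ⟨x, hx, rfl⟩ := hf
    intro t ht
    refine ⟨x, hx, ?_⟩
    simpa [monoN, Finsupp.single_apply_ne_zero] using ht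
  | algebraMap a =>
    intro t ht
    refine ⟨0, S.zero_mem, ?_⟩
    have h0 : stdExp σ (0 : Fin r → ℤ) = 0 := funext fun i => by simp [stdExp, lin_zero]
    rw [h0]
    rw [AddMonoidAlgebra.coe_algebraMap] at ht
    simpa using (Finsupp.mem_support_single _ _ _).mp ht |>.1
  | add f g _ _ hf hg =>
    intro t ht
    rcases Finset.mem_union.mp (Finsupp.support_add ht) with h | h
    · exact hf t h
    · exact hg t h
  | mul f g _ _ hf hg =>
    intro t ht
    obtain ⟨a, ha, b, hb, rfl⟩ :=
      Finset.mem_add.mp (AddMonoidAlgebra.support_coeff_mul_subset _ _ ht)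
    obtain ⟨v, hv, rfl⟩ := hf a ha
    obtain ⟨w, hw, rfl⟩ := hg b hb
    exact ⟨v + w, S.add_mem hv hw, (stdExp_add hrep hv hw).symm⟩

lemma exists_eq_stdExp_add_of_mem_span
    (hrep : ∀ x : Fin r → ℤ, x ∈ S ↔ ∀ i, 0 ≤ lin (σ i) x) {X : Set (Fin r → ℤ)} (hX : X ⊆ S)
    {f : stdRingP K S σ}
    (hf : f ∈ Ideal.span {f : stdRingP K S σ | ∃ x ∈ X,
      (f : AddMonoidAlgebra K (Fin s → ℕ)) = monoN K (stdExp σ x)}) :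
    ∀ t ∈ (f : AddMonoidAlgebra K (Fin s → ℕ)).coeff.support,
      ∃ x ∈ X, ∃ w ∈ S, t = stdExp σ (w + x) := by
  classical
  induction hf using Submodule.span_induction with
  | mem f hf =>
    obtain ⟨x, hx, hf⟩ := hf
    intro t ht
    refine ⟨x, hx, 0, S.zero_mem, ?_⟩
    rw [hf] at ht
    simpa [monoN, Finsupp.single_apply_ne_zero] using ht
  | zero => intro t ht; simp at ht
  | add f g _ _ hf hg =>
    intro t ht
    rcases Finset.mem_union.mp (Finsupp.support_add ht) with h | h
    · exact hf t h
    · exact hg t h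
  | smul a f _ hf =>
    intro t ht
    obtain ⟨u, hu, v, hv, rfl⟩ :=
      Finset.mem_add.mp (AddMonoidAlgebra.support_coeff_mul_subset _ _ ht)
    obtain ⟨w, hw, rfl⟩ := exists_eq_stdExp_of_mem_support hrep a.2 u hu
    obtain ⟨x, hx, w', hw', rfl⟩ := hf v hv
    refine ⟨x, hx, w + w', S.add_mem hw hw', ?_⟩
    rw [add_assoc, stdExp_add hrep hw (S.add_mem hw' (hX hx))]

/-- A sequence of monomials of `R` that is weakly regular on `R` is weakly regular on `P`. -/
lemma isWeaklyRegular_map_val_of_monomials (hSpos : ∀ x ∈ S, -x ∈ S → x = 0)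
    (hSgp : ∀ x : Fin r → ℤ, ∃ a ∈ S, ∃ b ∈ S, x = a - b)
    (hrep : ∀ x : Fin r → ℤ, x ∈ S ↔ ∀ i, 0 ≤ lin (σ i) x)
    (hirr : ∀ j, ∃ x : Fin r → ℤ, lin (σ j) x < 0 ∧ ∀ i, i ≠ j → 0 ≤ lin (σ i) x)
    (hprim : ∀ i, Finset.univ.gcd (σ i) = 1) {rs : List (stdRingP K S σ)}
    (hmono : ∀ f ∈ rs, ∃ x ∈ S, x ≠ 0 ∧
      (f : AddMonoidAlgebra K (Fin s → ℕ)) = monoN K (stdExp σ x))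
    (hrs : IsWeaklyRegular (stdRingP K S σ) rs) :
    IsWeaklyRegular (AddMonoidAlgebra K (Fin s → ℕ))
      (rs.map (algebraMap (stdRingP K S σ) (AddMonoidAlgebra K (Fin s → ℕ)))) := by
  have hex : ∀ k, ∃ x, ∀ hk : k < rs.length, x ∈ S ∧ x ≠ 0 ∧
      (rs[k] : AddMonoidAlgebra K (Fin s → ℕ)) = monoN K (stdExp σ x) := by
    intro k
    by_cases hk : k < rs.length
    · obtain ⟨x, h1, h2, h3⟩ := hmono rs[k] (List.getElem_mem hk)
      exact ⟨x, fun _ => ⟨h1, h2, h3⟩⟩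
    · exact ⟨0, fun h => absurd h hk⟩
  choose x hx using hex
  have hmem : ∀ y ∈ S, monoN K (stdExp σ y) ∈ stdRingP K S σ := fun y hy =>
    Algebra.subset_adjoin ⟨y, hy, rfl⟩
  have hmul : ∀ y ∈ S, ∀ z ∈ S,
      monoN K (stdExp σ (y + z)) = monoN K (stdExp σ y) * monoN K (stdExp σ z) := by
    intro y hy z hz
    rw [stdExp_add hrep hy hz, monoN, monoN, monoN, AddMonoidAlgebra.single_mul_single, one_mul]
  have hreg : ∀ k < rs.length, IsRegularMod S x {l | l < k} k := by
    rintro k hk y hy ⟨l, hl, hlS⟩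
    have hlk : l < rs.length := lt_trans hl hk
    have h1 := (isSMulRegular_quotient_iff_mem_of_smul_mem _ _).mp (hrs.regular_mod_prev k hk)
      ⟨_, hmem y hy⟩ (by
        have heq : rs[k] • (⟨_, hmem y hy⟩ : stdRingP K S σ) = ⟨_, hmem _ hlS⟩ * rs[l] := by
          refine Subtype.ext ?_
          rw [smul_eq_mul, MulMemClass.coe_mul, MulMemClass.coe_mul, (hx k hk).2.2,
            (hx l hlk).2.2, ← hmul _ (hx k hk).1 _ hy, ← hmul _ hlS _ (hx l hlk).1,
            sub_add_cancel, add_comm]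
        rw [heq, smul_eq_mul, Ideal.mul_top]
        refine Ideal.mul_mem_left _ _ (Ideal.subset_span ?_)
        exact List.mem_take_iff_getElem.mpr ⟨l, lt_min hl hlk, rfl⟩)
    rw [smul_eq_mul, Ideal.mul_top] at h1
    have h2 : Ideal.ofList (rs.take k) ≤ Ideal.span {f : stdRingP K S σ | ∃ z ∈ x '' {l | l < k},
        (f : AddMonoidAlgebra K (Fin s → ℕ)) = monoN K (stdExp σ z)} := by
      refine Ideal.span_mono fun f hf => ?_
      obtain ⟨l, hl, rfl⟩ := List.mem_take_iff_getElem.mp hf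
      exact ⟨x l, ⟨l, (lt_min_iff.mp hl).1, rfl⟩, (hx l _).2.2⟩
    have hXS : x '' {l | l < k} ⊆ S := by
      rintro _ ⟨l, hl, rfl⟩
      exact (hx l (lt_trans hl hk)).1
    obtain ⟨_, ⟨l, hl, rfl⟩, w, hw, hyw⟩ := exists_eq_stdExp_add_of_mem_span hrep hXS (h2 h1)
      (stdExp σ y) (by simp [monoN])
    refine ⟨l, hl, ?_⟩
    rw [stdExp_injOn hSpos hrep hy (S.add_mem hw (hXS ⟨l, hl, rfl⟩)) hyw, add_sub_cancel_right]
    exact hw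
  let deg : (Fin r → ℤ) →+ ℤ :=
    ∑ i, (⟨⟨lin (σ i), lin_zero _⟩, lin_add _⟩ : (Fin r → ℤ) →+ ℤ)
  have hdeg : ∀ y, deg y = ∑ i, lin (σ i) y := fun y => AddMonoidHom.finsetSum_apply _ _ _
  have hdeg0 : ∀ y ∈ S, 0 ≤ deg y := fun y hy => by
    rw [hdeg]
    exact Finset.sum_nonneg fun i _ => (hrep y).mp hy i
  have hdegpos : ∀ k < rs.length, 0 < deg (x k) := by
    intro k hk
    obtain ⟨hS, h0, -⟩ := hx k hk
    refine lt_of_le_of_ne (hdeg0 _ hS) fun h => h0 ?_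
    rw [hdeg, eq_comm, Finset.sum_eq_zero_iff_of_nonneg fun i _ => (hrep _).mp hS i] at h
    exact eq_zero_of_lin_eq_zero (σ := σ) hSpos hrep fun i => h i (Finset.mem_univ i)
  refine isWeaklyRegular_of_disjoint_supports _ (fun k => stdExp σ (x k)) ?_ ?_
  · intro k hk
    rw [List.getElem_map]
    exact (hx k _).2.2
  · intro j k hjk hk i
    rw [List.length_map] at hk
    exact stdExp_eq_zero_or_of_isRegularMod hSgp hrep hirr hprim (hx j (hjk.trans hk)).1
      (hx k hk).1 (isRegularMod_singleton deg hdeg0 hdegpos (fun k hk => (hx k hk).1) hreg hjk hk) i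

end DisjointSupports

/-- Theorem: the minimal depth of the divisor classes.
With `R = K[S] ⊆ P = K[Y_1,…,Y_s]` the standard embedding and `𝔪 ⊆ R` the irrelevant
maximal ideal: if `λ` is the maximal length of a regular sequence of monomials in `𝔪`,
`g = grade(𝔪P)` is the maximal length of a `P`-regular sequence in `𝔪P`, and `dep c` is
the length of a maximal `M_c`-regular sequence in `𝔪` for each class `c`, then
`λ ≤ grade(𝔪P) = min {depth M_c : c ∈ Cl(R)}`. -/
theorem depth_of_divisor_classes
    {r s : ℕ} (K : Type*) [Field K]
    (S : AddSubmonoid (Fin r → ℤ)) (σ : Fin s → Fin r → ℤ)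
    (hSfg : S.FG)
    (hSpos : ∀ x ∈ S, -x ∈ S → x = 0)
    (hSgp : ∀ x : Fin r → ℤ, ∃ a ∈ S, ∃ b ∈ S, x = a - b)
    (hrep : ∀ x : Fin r → ℤ, x ∈ S ↔ ∀ i, 0 ≤ lin (σ i) x)
    (hirr : ∀ j, ∃ x : Fin r → ℤ, lin (σ j) x < 0 ∧ ∀ i, i ≠ j → 0 ≤ lin (σ i) x)
    (hprim : ∀ i, Finset.univ.gcd (σ i) = 1)
    (lam g : ℕ) (dep : classGroup σ → ℕ)
    (hlam : IsGreatest {l : ℕ | ∃ rs : List ↥(stdRingP K S σ), rs.length = l ∧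
      (∀ f ∈ rs, ∃ x ∈ S, x ≠ 0 ∧
        (f : AddMonoidAlgebra K (Fin s → ℕ)) = monoN K (stdExp σ x)) ∧
      RingTheory.Sequence.IsRegular ↥(stdRingP K S σ) rs} lam)
    (hg : IsGreatest {l : ℕ | ∃ rs : List (AddMonoidAlgebra K (Fin s → ℕ)),
      rs.length = l ∧ (∀ f ∈ rs, f ∈ extIdealP K S σ) ∧
      RingTheory.Sequence.IsRegular (AddMonoidAlgebra K (Fin s → ℕ)) rs} g)
    (hdep : ∀ c : classGroup σ, IsGreatest {l : ℕ | ∃ rs : List ↥(stdRingP K S σ),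
      rs.length = l ∧ (∀ f ∈ rs, f ∈ irrIdealP K S σ) ∧
      RingTheory.Sequence.IsRegular ↥(cosetModuleP K S σ c) rs} (dep c)) :
    lam ≤ g ∧ g = sInf (Set.range dep) := by
  have hextIdeal : extIdealP K S σ ≠ ⊤ := extIdealP_ne_top hSpos hrep
  have hmapmem : ∀ fs : List (stdRingP K S σ), (∀ a ∈ fs, a ∈ irrIdealP K S σ) →
      ∀ b ∈ fs.map (algebraMap (stdRingP K S σ) (AddMonoidAlgebra K (Fin s → ℕ))),
        b ∈ extIdealP K S σ := by
    intro fs hfs b hb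
    obtain ⟨a, ha, rfl⟩ := List.mem_map.mp hb
    exact coe_mem_extIdealP (hfs a ha)
  have hbd : ∀ fs : List (stdRingP K S σ), (∀ a ∈ fs, a ∈ irrIdealP K S σ) →
      RingTheory.Sequence.IsWeaklyRegular (AddMonoidAlgebra K (Fin s → ℕ)) fs → fs.length ≤ g :=
    fun fs hfs h =>
    hg.2 ⟨_, List.length_map _, hmapmem fs hfs,
      isRegular_of_forall_mem hextIdeal (hmapmem fs hfs)
        ((RingTheory.Sequence.isWeaklyRegular_map_algebraMap_iff _ _ _).mpr h)⟩
  constructor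
  · obtain ⟨rs, rfl, hmono, hrs⟩ := hlam.1
    have hw := isWeaklyRegular_map_val_of_monomials hSpos hSgp hrep hirr hprim hmono
      hrs.toIsWeaklyRegular
    refine hbd rs (fun f hf => Ideal.subset_span (hmono f hf)) ?_
    exact (RingTheory.Sequence.isWeaklyRegular_map_algebraMap_iff _ _ _).mp hw
  obtain ⟨fs, hfs, hfsreg, u, hu, hku⟩ :=
    exists_isWeaklyRegular_of_bounded (B := AddMonoidAlgebra K (Fin s → ℕ))
      (irrIdealP K S σ) g hbd
  have hgk : g = fs.length := by
    refine le_antisymm ?_ (hbd fs hfs hfsreg)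
    obtain ⟨gs, rfl, hgs, hgsreg⟩ := hg.1
    have hJ : ∀ v : AddMonoidAlgebra K (Fin s → ℕ),
        v ∈ (Ideal.ofList fs • ⊤ : Submodule (stdRingP K S σ) (AddMonoidAlgebra K (Fin s → ℕ))) ↔
        v ∈ Ideal.ofList (fs.map (algebraMap (stdRingP K S σ)
          (AddMonoidAlgebra K (Fin s → ℕ)))) := fun v => by
      rw [Ideal.smul_top_eq_map, Ideal.map_ofList]
      rfl
    refine length_le_of_isWeaklyRegular_of_smul_mem (extIdealP K S σ) (hmapmem fs hfs) hgs
      ((RingTheory.Sequence.isWeaklyRegular_map_algebraMap_iff _ _ _).mpr hfsreg)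
      hgsreg.toIsWeaklyRegular (u := u) ?_ ?_
        |>.trans_eq (List.length_map _)
    · rwa [smul_eq_mul, Ideal.mul_top, ← hJ]
    · intro a ha
      rw [smul_eq_mul, Ideal.mul_top]
      induction ha using Submodule.span_induction with
      | mem a ha =>
        obtain ⟨x, hx, hx0, rfl⟩ := ha
        have hmem : monoN K (stdExp σ x) ∈ stdRingP K S σ := Algebra.subset_adjoin ⟨x, hx, rfl⟩
        exact (hJ _).mp (hku ⟨_, hmem⟩ (Ideal.subset_span ⟨x, hx, hx0, rfl⟩))
      | zero => rw [zero_smul]; exact zero_mem _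
      | add a b _ _ ha hb => rw [add_smul]; exact add_mem ha hb
      | smul a b _ hb => rw [smul_assoc]; exact Ideal.mul_mem_left _ _ hb
  have hreg : ∀ c, RingTheory.Sequence.IsWeaklyRegular (cosetModuleP K S σ c) fs := fun c =>
    isWeaklyRegular_of_retract _ _ (cosetProj_comp_subtype hrep c) hfsreg
  have hofList : Ideal.ofList fs ≤ irrIdealP K S σ := Ideal.span_le.mpr hfs
  have hle : ∀ c, fs.length ≤ dep c := fun c =>
    (hdep c).2 ⟨fs, rfl, hfs, hreg c, fun htop =>
      irrIdealP_smul_top_ne_top hSpos hSgp hrep hprim c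
        (top_le_iff.mp (htop.le.trans (Submodule.smul_mono_left hofList)))⟩
  obtain ⟨c, hc⟩ : ∃ c, cosetProj hrep c u ∉
      (Ideal.ofList fs • ⊤ : Submodule (stdRingP K S σ) (cosetModuleP K S σ c)) := by
    by_contra! h
    exact hu (mem_smul_top_of_cosetProj hrep _ h)
  have hge : dep c ≤ fs.length := by
    obtain ⟨gs, hlen, hgs, hgsreg⟩ := (hdep c).1
    rw [← hlen]
    refine length_le_of_isWeaklyRegular_of_smul_mem (irrIdealP K S σ) hfs hgs (hreg c)
      hgsreg.toIsWeaklyRegular hc fun a ha => ?_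
    rw [← map_smul]
    exact Submodule.smul_top_le_comap_smul_top _ (cosetProj hrep c) (hku a ha)
  rw [hgk]
  refine le_antisymm (le_csInf (Set.range_nonempty dep) ?_)
    ((Nat.sInf_le (Set.mem_range_self c)).trans hge)
  rintro _ ⟨c, rfl⟩
  exact hle c
end
end

section
/- Let K be a field, S a positive normal affine semigroup with gp(S) = ℤ^r, R = K[S], σ : R → P = K[Y_1,…,Y_s] the standard embedding and 𝔪 the maximal ideal of R generated by all nonunit monomials. Then grade(𝔪P), the maximal length of a P-regular sequence contained in 𝔪P, equals the minimal number u for which there exist facets F_{i_1},…,F_{i_u} of the cone C(S) with F_{i_1} ∩ … ∩ F_{i_u} = {0}. -/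
set_option synthInstance.maxHeartbeats 1000000
set_option maxHeartbeats 1000000

open scoped BigOperators

noncomputable section

/-- The cone `C(S) ⊆ ℝ^r` generated by a set `Sset ⊆ ℤ^r`: all finite linear combinations
of elements of `Sset` with nonnegative real coefficients. -/
def coneOf {r : ℕ} (Sset : Set (Fin r → ℤ)) : Set (Fin r → ℝ) :=
  {x | ∃ (t : Finset (Fin r → ℤ)) (c : (Fin r → ℤ) → ℝ),
    (↑t : Set (Fin r → ℤ)) ⊆ Sset ∧ (∀ v, 0 ≤ c v) ∧
    x = ∑ v ∈ t, c v • (fun k => (v k : ℝ))}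

open RingTheory.Sequence Function Pointwise in
/-- Weak regularity of a sequence passes from the two ends of a short exact sequence to its
middle term. -/
lemma isWeaklyRegular_of_exact {R : Type*} [CommRing R] (rs : List R) {M M' M'' : Type*}
    [AddCommGroup M] [Module R M] [AddCommGroup M'] [Module R M'] [AddCommGroup M''] [Module R M'']
    {f : M →ₗ[R] M'} {g : M' →ₗ[R] M''} (hf : Injective f) (hfg : Exact f g) (hg : Surjective g)
    (h : IsWeaklyRegular M rs) (h'' : IsWeaklyRegular M'' rs) : IsWeaklyRegular M' rs := by
  induction rs generalizing M M' M'' with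
  | nil => simp
  | cons a rs ih =>
    rw [isWeaklyRegular_cons_iff] at h h'' ⊢
    refine ⟨isSMulRegular_of_range_eq_ker hf (LinearMap.exact_iff.mp hfg).symm h.1 h''.1,
      ih (f := QuotSMulTop.map a f) (g := QuotSMulTop.map a g) ?_ (QuotSMulTop.map_exact a hfg hg)
        (QuotSMulTop.map_surjective a hg) h.2 h''.2⟩
    have h0 : Exact (0 : M →ₗ[R] M) f := by
      intro x
      constructor
      · intro hx
        exact ⟨0, (hf (by simpa using hx)).symm⟩
      · rintro ⟨y, rfl⟩
        simp
    have h1 := QuotSMulTop.map_first_exact_on_four_term_exact_of_isSMulRegular_last h0 hfg h''.1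
    rw [injective_iff_map_eq_zero]
    intro x hx
    obtain ⟨y, rfl⟩ := (h1 x).mp hx
    simp

open RingTheory.Sequence Function Pointwise in
lemma isWeaklyRegular_quotSMulTop_mul {R M : Type*} [CommRing R] [AddCommGroup M] [Module R M]
    {a b : R} (rs : List R) (ha : IsSMulRegular M a) (hra : IsWeaklyRegular (QuotSMulTop a M) rs)
    (hrb : IsWeaklyRegular (QuotSMulTop b M) rs) :
    IsWeaklyRegular (QuotSMulTop (a * b) M) rs := by
  have hf : (b • ⊤ : Submodule R M) ≤ Submodule.comap (LinearMap.lsmul R M a) ((a * b) • ⊤) := by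
    rintro _ ⟨x, -, rfl⟩
    exact ⟨x, trivial, by simp [mul_smul, smul_comm a b x]⟩
  have hg : ((a * b) • ⊤ : Submodule R M) ≤ a • ⊤ := by
    rintro _ ⟨x, -, rfl⟩
    exact ⟨b • x, trivial, (mul_smul a b x).symm⟩
  refine isWeaklyRegular_of_exact rs (f := Submodule.mapQ _ _ _ hf) (g := Submodule.factor hg)
    ?_ ?_ (Submodule.factor_surjective hg) hrb hra
  · rw [injective_iff_map_eq_zero]
    intro x
    obtain ⟨x, rfl⟩ := Submodule.Quotient.mk_surjective _ x
    intro hx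
    obtain ⟨y, -, hy⟩ := (Submodule.Quotient.mk_eq_zero _).mp hx
    rw [Submodule.Quotient.mk_eq_zero]
    exact ⟨y, trivial, ha (by simpa [mul_smul] using hy)⟩
  · intro x
    obtain ⟨x, rfl⟩ := Submodule.Quotient.mk_surjective _ x
    constructor
    · intro hx
      obtain ⟨y, -, rfl⟩ := (Submodule.Quotient.mk_eq_zero _).mp hx
      exact ⟨Submodule.Quotient.mk y, rfl⟩
    · rintro ⟨y, hy⟩
      obtain ⟨y, rfl⟩ := Submodule.Quotient.mk_surjective _ y
      rw [← hy]
      exact (Submodule.Quotient.mk_eq_zero _).mpr ⟨y, trivial, rfl⟩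

open RingTheory.Sequence Pointwise in
lemma isWeaklyRegular_quotSMulTop_prod {R M : Type*} [CommRing R] [AddCommGroup M] [Module R M]
    (rs : List R) (l : List R) (hl : ∀ y ∈ l, IsSMulRegular M y)
    (hrs : ∀ y ∈ l, IsWeaklyRegular (QuotSMulTop y M) rs) :
    IsWeaklyRegular (QuotSMulTop l.prod M) rs := by
  induction l with
  | nil =>
    have : Subsingleton (QuotSMulTop (1 : R) M) := by
      rw [Submodule.Quotient.subsingleton_iff, one_smul]
    refine ⟨fun i hi x y _ => ?_⟩
    obtain ⟨x, rfl⟩ := Submodule.Quotient.mk_surjective _ x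
    obtain ⟨y, rfl⟩ := Submodule.Quotient.mk_surjective _ y
    exact congrArg _ (this.elim x y)
  | cons a l ih =>
    rw [List.prod_cons]
    exact isWeaklyRegular_quotSMulTop_mul rs (hl a (by simp)) (hrs a (by simp))
      (ih (fun y hy => hl y (by simp [hy])) fun y hy => hrs y (by simp [hy]))

lemma Multiset.esymm_cons_succ {R : Type*} [CommSemiring R] (a : R) (m : Multiset R) (k : ℕ) :
    (a ::ₘ m).esymm (k + 1) = m.esymm (k + 1) + a * m.esymm k := by
  simp [Multiset.esymm, Multiset.powersetCard_cons, Multiset.sum_map_mul_left]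

lemma isSMulRegular_list_prod {R M : Type*} [CommRing R] [AddCommGroup M] [Module R M]
    (l : List R) (hl : ∀ y ∈ l, IsSMulRegular M y) : IsSMulRegular M l.prod := by
  induction l with
  | nil => simp
  | cons a l ih =>
    rw [List.prod_cons]
    exact (hl a (by simp)).mul (ih fun y hy => hl y (by simp [hy]))

open RingTheory.Sequence Pointwise in
/-- If every ordering of the family `y` over `t` is weakly regular, then so is the sequence
`e_n, …, e_1` of elementary symmetric polynomials of its `n` members. -/
lemma isWeaklyRegular_esymm {R ι : Type*} [CommRing R] (y : ι → R) (n : ℕ) {M : Type*}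
    [AddCommGroup M] [Module R M] (t : Multiset ι) (ht : t.card = n)
    (h : ∀ l : List ι, (l : Multiset ι) = t → IsWeaklyRegular M (l.map y)) :
    IsWeaklyRegular M ((List.range n).map fun k => (t.map y).esymm (n - k)) := by
  induction n generalizing M t with
  | zero => simp
  | succ n ih =>
    have hcons : ∀ i ∈ t, ∃ t', t = i ::ₘ t' ∧ IsSMulRegular M (y i) ∧
        ∀ l : List ι, (l : Multiset ι) = t' → IsWeaklyRegular (QuotSMulTop (y i) M) (l.map y) := by
      intro i hi
      obtain ⟨t', rfl⟩ := Multiset.exists_cons_of_mem hi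
      have key : ∀ l : List ι, (l : Multiset ι) = t' → IsWeaklyRegular M (y i :: l.map y) :=
        fun l hl => h (i :: l) (by rw [← hl]; rfl)
      exact ⟨t', rfl, ((isWeaklyRegular_cons_iff _ _ _).mp (key t'.toList (by simp))).1,
        fun l hl => ((isWeaklyRegular_cons_iff _ _ _).mp (key l hl)).2⟩
    have htop : (t.map y).esymm (n + 1) = (t.toList.map y).prod := by
      have hc : (t.map y).card = n + 1 := by simpa using ht
      rw [← hc, ← Multiset.prod_coe, ← Multiset.map_coe, Multiset.coe_toList]
      simp [Multiset.esymm, -Multiset.card_map]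
    rw [List.range_succ_eq_map, List.map_cons, List.map_map, isWeaklyRegular_cons_iff, Nat.sub_zero,
      htop]
    refine ⟨isSMulRegular_list_prod _ ?_, isWeaklyRegular_quotSMulTop_prod _ _ ?_ ?_⟩
    · simp only [List.forall_mem_map, Multiset.mem_toList]
      intro i hi
      obtain ⟨_, -, hreg, -⟩ := hcons i hi
      exact hreg
    · simp only [List.forall_mem_map, Multiset.mem_toList]
      intro i hi
      obtain ⟨_, -, hreg, -⟩ := hcons i hi
      exact hreg
    · simp only [List.forall_mem_map, Multiset.mem_toList]
      intro i hi
      obtain ⟨t', rfl, -, ht'⟩ := hcons i hi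
      refine (AddEquiv.isWeaklyRegular_congr (e := AddEquiv.refl _) ?_).mp
        (ih t' (by simpa using ht) ht')
      rw [List.forall₂_map_left_iff, List.forall₂_map_right_iff, List.forall₂_same]
      intro k hk x
      obtain ⟨j, hj⟩ : ∃ j, n - k = j + 1 := ⟨n - k - 1, by have := List.mem_range.mp hk; omega⟩
      have hy0 : ∀ z : QuotSMulTop (y i) M, y i • z = 0 :=
        Module.mem_annihilator.mp (QuotSMulTop.mem_annihilator M (y i))
      simp [hj, Multiset.esymm_cons_succ, add_smul, mul_smul, hy0]

open RingTheory.Sequence in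
/-- In a Noetherian ring, a weakly regular sequence in a proper ideal generated by a finite set
is no longer than the set. -/
lemma length_le_card_of_isWeaklyRegular {R : Type*} [CommRing R] [IsNoetherianRing R]
    (G : Finset R) (hG : Ideal.span (G : Set R) ≠ ⊤) (rs : List R) (hrs : IsWeaklyRegular R rs)
    (hmem : ∀ f ∈ rs, f ∈ Ideal.span (G : Set R)) : rs.length ≤ G.card := by
  obtain ⟨p, hp⟩ := Ideal.nonempty_minimalPrimes hG
  have : p.IsPrime := hp.1.1
  have hht := Ideal.height_le_card_of_mem_minimalPrimes_span_finset hp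
  have hreg := hrs.isRegular_of_isLocalization_of_mem (Localization.AtPrime p) p
    fun f hf => hp.1.2 (hmem f hf)
  have hd := ringKrullDim_add_length_eq_ringKrullDim_of_isRegular _ hreg
  rw [IsLocalization.AtPrime.ringKrullDim_eq_height p (Localization.AtPrime p), List.length_map] at hd
  have hnt : Nontrivial (Localization.AtPrime p ⧸
      Ideal.ofList (rs.map (algebraMap R (Localization.AtPrime p)))) := by
    rw [Ideal.Quotient.nontrivial_iff]
    simpa using hreg.top_ne_smul.symm
  have h0 := ringKrullDim_nonneg_of_nontrivial (R := Localization.AtPrime p ⧸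
      Ideal.ofList (rs.map (algebraMap R (Localization.AtPrime p))))
  have h1 : ((rs.length : ℕ∞) : WithBot ℕ∞) ≤ (p.height : WithBot ℕ∞) := by
    rw [← hd]
    simpa using add_le_add_left h0 (rs.length : WithBot ℕ∞)
  exact_mod_cast (WithBot.coe_le_coe.mp h1).trans hht

lemma monoN_add (K : Type*) [Field K] {s : ℕ} (a b : Fin s → ℕ) :
    monoN K (a + b) = monoN K a * monoN K b := by
  simp [monoN, AddMonoidAlgebra.single_mul_single]

lemma monoN_zero (K : Type*) [Field K] {s : ℕ} : monoN K (0 : Fin s → ℕ) = 1 := rfl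

lemma monoN_dvd_monoN (K : Type*) [Field K] {s : ℕ} {a b : Fin s → ℕ} (h : a ≤ b) :
    monoN K a ∣ monoN K b :=
  ⟨monoN K (b - a), by rw [← monoN_add, add_tsub_cancel_of_le h]⟩

lemma monoN_sum (K : Type*) [Field K] {s : ℕ} {ι : Type*} (t : Finset ι) (a : ι → Fin s → ℕ) :
    ∏ i ∈ t, monoN K (a i) = monoN K (∑ i ∈ t, a i) := by
  classical
  induction t using Finset.induction_on with
  | empty => simp [monoN_zero]
  | insert i t hi ih => rw [Finset.prod_insert hi, Finset.sum_insert hi, monoN_add, ih]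

instance isNoetherianRing_addMonoidAlgebra (K : Type*) [Field K] (s : ℕ) :
    IsNoetherianRing (AddMonoidAlgebra K (Fin s → ℕ)) := by
  have : AddMonoid.FG (Fin s → ℕ) := inferInstance
  exact Algebra.FiniteType.isNoetherianRing K _

lemma pi_single_le_of_le {s N : ℕ} {i : Fin s} {m : Fin s → ℕ} (h : N ≤ m i) :
    Pi.single i N ≤ m := by
  intro j
  by_cases hj : j = i
  · subst hj
    simpa using h
  · simp [hj]

lemma mem_span_variable_pow_iff (K : Type*) [Field K] {s : ℕ} (N : ℕ) (T : Set (Fin s))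
    (f : AddMonoidAlgebra K (Fin s → ℕ)) :
    f ∈ Ideal.span ((fun i => monoN K (Pi.single i N)) '' T) ↔
      ∀ m ∈ f.coeff.support, ∃ i ∈ T, N ≤ m i := by
  have h : (fun i : Fin s => monoN K (Pi.single i N)) '' T =
      AddMonoidAlgebra.of' K (Fin s → ℕ) '' ((fun i => Pi.single i N) '' T) := by
    rw [Set.image_image]
    rfl
  rw [h, AddMonoidAlgebra.mem_ideal_span_of'_image]
  refine forall₂_congr fun m _ => ?_
  rw [Set.exists_mem_image]
  refine exists_congr fun i => and_congr_right fun _ => ?_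
  constructor
  · rintro ⟨d, rfl⟩
    simp
  · intro hi
    exact ⟨m - Pi.single i N, (tsub_add_cancel_of_le (pi_single_le_of_le hi)).symm⟩

open RingTheory.Sequence in
lemma isWeaklyRegular_variable_pow (K : Type*) [Field K] {s : ℕ} (N : ℕ) (l : List (Fin s))
    (hl : l.Nodup) : IsWeaklyRegular (AddMonoidAlgebra K (Fin s → ℕ))
      (l.map fun i => monoN K (Pi.single i N)) := by
  refine ⟨fun k hk => ?_⟩
  rw [List.length_map] at hk
  have hideal : (Ideal.ofList ((l.map fun i => monoN K (Pi.single i N)).take k) • ⊤ :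
      Ideal (AddMonoidAlgebra K (Fin s → ℕ))) =
      Ideal.span ((fun i => monoN K (Pi.single i N)) '' {i | i ∈ l.take k}) := by
    rw [smul_eq_mul, Ideal.mul_top, Ideal.ofList, ← List.map_take]
    congr 1
    ext f
    simp only [Set.mem_ofPred_eq, List.mem_map, Set.mem_image]
  rw [isSMulRegular_quotient_iff_mem_of_smul_mem, hideal]
  intro f
  rw [mem_span_variable_pow_iff, mem_span_variable_pow_iff, List.getElem_map]
  intro hf m hm
  obtain ⟨i, hi, hle⟩ := hf (Pi.single l[k] N + m) <| by
    rw [Finsupp.mem_support_iff] at hm ⊢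
    rw [smul_eq_mul, monoN]
    simpa using hm
  have hne : i ≠ l[k] := by
    rintro rfl
    obtain ⟨j, hj, hjk⟩ := List.mem_take_iff_getElem.mp hi
    have := hl.getElem_inj_iff.mp hjk
    omega
  exact ⟨i, hi, by simpa [Pi.single_apply, hne] using hle⟩

/-- The facets indexed by `I` have no common nonzero element of `S`. -/
def FacetsMeetTrivially {r s : ℕ} (S : AddSubmonoid (Fin r → ℤ)) (σ : Fin s → Fin r → ℤ)
    (I : Finset (Fin s)) : Prop :=
  ∀ x ∈ S, x ≠ 0 → ∃ i ∈ I, lin (σ i) x ≠ 0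

lemma iInter_facets_eq_zero_iff {r s : ℕ} (S : AddSubmonoid (Fin r → ℤ)) (σ : Fin s → Fin r → ℤ)
    (hSgp : ∀ x : Fin r → ℤ, ∃ a ∈ S, ∃ b ∈ S, x = a - b)
    (hrep : ∀ x : Fin r → ℤ, x ∈ S ↔ ∀ i, 0 ≤ lin (σ i) x) (I : Finset (Fin s)) :
    (⋂ i ∈ I, {x ∈ coneOf (S : Set (Fin r → ℤ)) | ∑ k, (σ i k : ℝ) * x k = 0}) = {0} ↔
      FacetsMeetTrivially S σ I := by
  have hcast : ∀ i (v : Fin r → ℤ), ∑ k, (σ i k : ℝ) * (v k : ℝ) = (lin (σ i) v : ℝ) := by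
    intro i v
    simp [lin]
  constructor
  · intro h x hx hx0
    by_contra! hcon
    have hmem : (fun k => (x k : ℝ)) ∈
        ⋂ i ∈ I, {x ∈ coneOf (S : Set (Fin r → ℤ)) | ∑ k, (σ i k : ℝ) * x k = 0} := by
      simp only [Set.mem_iInter]
      intro i hi
      refine ⟨⟨{x}, fun _ => 1, by simpa using hx, by simp, by simp⟩, ?_⟩
      rw [hcast, hcon i hi, Int.cast_zero]
    rw [h, Set.mem_singleton_iff] at hmem
    exact hx0 (funext fun k => by simpa using congrFun hmem k)
  · intro h
    refine Set.eq_singleton_iff_unique_mem.mpr ⟨?_, fun x hx => ?_⟩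
    · simp only [Set.mem_iInter]
      exact fun i _ => ⟨⟨∅, 0, by simp, by simp, by simp⟩, by simp⟩
    · simp only [Set.mem_iInter] at hx
      rcases I.eq_empty_or_nonempty with rfl | ⟨i₀, hi₀⟩
      · have hS : ∀ a ∈ S, a = 0 := by
          intro a ha
          by_contra ha0
          simpa using h a ha ha0
        ext k
        obtain ⟨a, ha, b, hb, hab⟩ := hSgp (Pi.single k 1)
        rw [hS a ha, hS b hb] at hab
        simpa using congrFun hab k
      · obtain ⟨t, c, ht, hc, rfl⟩ := (hx i₀ hi₀).1
        refine Finset.sum_eq_zero fun v hv => ?_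
        by_cases hv0 : v = 0
        · ext k
          simp [hv0]
        obtain ⟨i, hi, hne⟩ := h v (ht hv) hv0
        have hsum : ∑ w ∈ t, c w * (lin (σ i) w : ℝ) = 0 := by
          rw [← (hx i hi).2]
          simp only [← hcast, Finset.sum_apply, Pi.smul_apply, smul_eq_mul, Finset.mul_sum]
          rw [Finset.sum_comm]
          exact Finset.sum_congr rfl fun _ _ => Finset.sum_congr rfl fun _ _ => by ring
        have hterm := (Finset.sum_eq_zero_iff_of_nonneg fun w hw =>
          mul_nonneg (hc w) (by exact_mod_cast (hrep w).mp (ht hw) i)).mp hsum v hv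
        have hcv : c v = 0 := by simpa [hne] using hterm
        simp [hcv]

lemma facetsMeetTrivially_univ {r s : ℕ} (S : AddSubmonoid (Fin r → ℤ)) (σ : Fin s → Fin r → ℤ)
    (hSpos : ∀ x ∈ S, -x ∈ S → x = 0)
    (hrep : ∀ x : Fin r → ℤ, x ∈ S ↔ ∀ i, 0 ≤ lin (σ i) x) :
    FacetsMeetTrivially S σ Finset.univ := by
  intro x hx hx0
  by_contra! h
  refine hx0 (hSpos x hx ((hrep _).mpr fun i => ?_))
  have hneg : lin (σ i) (-x) = -lin (σ i) x := by simp [lin]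
  rw [hneg, h i (Finset.mem_univ i), neg_zero]

lemma span_variable_ne_top (K : Type*) [Field K] {s : ℕ} (T : Set (Fin s)) :
    Ideal.span ((fun i => monoN K (Pi.single i 1)) '' T) ≠ ⊤ := by
  rw [Ideal.ne_top_iff_one, ← monoN_zero, mem_span_variable_pow_iff]
  intro h
  obtain ⟨i, -, hi⟩ := h 0 (by simp [monoN])
  simp at hi

lemma extIdealP_le_span_variable (K : Type*) [Field K] {r s : ℕ} (S : AddSubmonoid (Fin r → ℤ))
    (σ : Fin s → Fin r → ℤ) (hrep : ∀ x : Fin r → ℤ, x ∈ S ↔ ∀ i, 0 ≤ lin (σ i) x)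
    {I : Finset (Fin s)} (hI : FacetsMeetTrivially S σ I) :
    extIdealP K S σ ≤ Ideal.span ((fun i => monoN K (Pi.single i 1)) '' (I : Set (Fin s))) := by
  refine Ideal.span_le.mpr ?_
  rintro _ ⟨x, hx, hx0, rfl⟩
  obtain ⟨i, hi, hne⟩ := hI x hx hx0
  refine Ideal.mem_of_dvd _ (monoN_dvd_monoN K (pi_single_le_of_le (N := 1) ?_))
    (Ideal.subset_span ⟨i, hi, rfl⟩)
  have := (hrep x).mp hx i
  simp only [stdExp]
  omega

open RingTheory.Sequence in
lemma length_le_card_of_facetsMeetTrivially (K : Type*) [Field K] {r s : ℕ}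
    (S : AddSubmonoid (Fin r → ℤ)) (σ : Fin s → Fin r → ℤ)
    (hrep : ∀ x : Fin r → ℤ, x ∈ S ↔ ∀ i, 0 ≤ lin (σ i) x)
    {I : Finset (Fin s)} (hI : FacetsMeetTrivially S σ I)
    (rs : List (AddMonoidAlgebra K (Fin s → ℕ))) (hmem : ∀ f ∈ rs, f ∈ extIdealP K S σ)
    (hrs : IsWeaklyRegular (AddMonoidAlgebra K (Fin s → ℕ)) rs) : rs.length ≤ I.card := by
  classical
  have hcoe : ((I.image fun i => monoN K (Pi.single i 1) : Finset _) : Set _) =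
      (fun i => monoN K (Pi.single i 1)) '' (I : Set (Fin s)) := Finset.coe_image
  refine (length_le_card_of_isWeaklyRegular (I.image fun i => monoN K (Pi.single i 1)) ?_ rs hrs
    fun f hf => ?_).trans Finset.card_image_le
  · rw [hcoe]
    exact span_variable_ne_top K _
  · rw [hcoe]
    exact extIdealP_le_span_variable K S σ hrep hI (hmem f hf)

/-- If no fewer than `u` facets meet trivially, then some power `N` is such that every product of
`N`-th powers of more than `s - u` variables lies in the ideal `𝔪P`. -/
lemma exists_prod_variable_pow_mem (K : Type*) [Field K] {r s : ℕ}
    (S : AddSubmonoid (Fin r → ℤ)) (σ : Fin s → Fin r → ℤ) (u : ℕ)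
    (hu : ∀ I, FacetsMeetTrivially S σ I → u ≤ I.card) :
    ∃ N, ∀ t : Finset (Fin s), s < t.card + u →
      ∏ i ∈ t, monoN K (Pi.single i N) ∈ extIdealP K S σ := by
  have hex : ∀ t : Finset (Fin s), ∃ x : Fin r → ℤ, s < t.card + u →
      x ∈ S ∧ x ≠ 0 ∧ ∀ i ∉ t, lin (σ i) x = 0 := by
    intro t
    by_cases ht : s < t.card + u
    · have hnot : ¬ FacetsMeetTrivially S σ tᶜ := fun h => by
        have := hu _ h
        have hle : t.card ≤ s := by simpa using t.card_le_univ
        rw [Finset.card_compl, Fintype.card_fin] at this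
        omega
      simp only [FacetsMeetTrivially, not_forall, not_exists, not_and, not_not,
        Finset.mem_compl] at hnot
      obtain ⟨x, hx, hx0, h⟩ := hnot
      exact ⟨x, fun _ => ⟨hx, hx0, h⟩⟩
    · exact ⟨0, fun h => absurd h ht⟩
  choose x hx using hex
  refine ⟨Finset.univ.sup fun t => Finset.univ.sup (stdExp σ (x t)), fun t ht => ?_⟩
  obtain ⟨hxS, hx0, hxt⟩ := hx t ht
  rw [monoN_sum]
  refine Ideal.mem_of_dvd _ (monoN_dvd_monoN K ?_) (Ideal.subset_span ⟨x t, hxS, hx0, rfl⟩)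
  intro i
  by_cases hi : i ∈ t
  · simp only [Finset.sum_apply, Pi.single_apply, Finset.sum_ite_eq, hi, if_true]
    exact (Finset.le_sup (f := stdExp σ (x t)) (Finset.mem_univ i)).trans
      (Finset.le_sup (f := fun t => Finset.univ.sup (stdExp σ (x t))) (Finset.mem_univ t))
  · simp [stdExp, hxt i hi]

open RingTheory.Sequence in
lemma exists_isRegular_of_le_card (K : Type*) [Field K] {r s : ℕ}
    (S : AddSubmonoid (Fin r → ℤ)) (σ : Fin s → Fin r → ℤ)
    (hrep : ∀ x : Fin r → ℤ, x ∈ S ↔ ∀ i, 0 ≤ lin (σ i) x)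
    (huniv : FacetsMeetTrivially S σ Finset.univ) (u : ℕ)
    (hu : ∀ I, FacetsMeetTrivially S σ I → u ≤ I.card) :
    ∃ rs : List (AddMonoidAlgebra K (Fin s → ℕ)), rs.length = u ∧
      (∀ f ∈ rs, f ∈ extIdealP K S σ) ∧ IsRegular (AddMonoidAlgebra K (Fin s → ℕ)) rs := by
  have hus : u ≤ s := by simpa using hu _ huniv
  obtain ⟨N, hN⟩ := exists_prod_variable_pow_mem K S σ u hu
  let e : ℕ → AddMonoidAlgebra K (Fin s → ℕ) := fun k =>
    ((Finset.univ : Finset (Fin s)).val.map fun i => monoN K (Pi.single i N)).esymm (s - k)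
  have hmem : ∀ f ∈ (List.range u).map e, f ∈ extIdealP K S σ := by
    simp only [List.forall_mem_map, List.mem_range]
    intro k hk
    simp only [e]
    rw [Finset.esymm_map_val]
    refine Ideal.sum_mem _ fun t ht => hN t ?_
    rw [(Finset.mem_powersetCard.mp ht).2]
    omega
  have hreg : IsWeaklyRegular (AddMonoidAlgebra K (Fin s → ℕ)) ((List.range s).map e) :=
    isWeaklyRegular_esymm _ s Finset.univ.val (by simp) fun l hl =>
      isWeaklyRegular_variable_pow K N l <| by
        rw [← Multiset.coe_nodup, hl]
        exact Finset.univ.nodup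
  refine ⟨(List.range u).map e, by simp, hmem, ?_, fun htop => ?_⟩
  · rw [← List.take_append_drop u ((List.range s).map e), isWeaklyRegular_append_iff,
      ← List.map_take, List.take_range, min_eq_left hus] at hreg
    exact hreg.1
  · rw [smul_eq_mul, Ideal.mul_top] at htop
    refine span_variable_ne_top K ((Finset.univ : Finset (Fin s)) : Set (Fin s))
      (top_le_iff.mp (htop.le.trans ?_))
    exact (Ideal.span_le.mpr hmem).trans (extIdealP_le_span_variable K S σ hrep huniv)

/-- Proposition: combinatorial description of `grade 𝔪P`.
The maximal length of a `P`-regular sequence contained in the extended ideal `𝔪P` equals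
the least number `u` of facets `F_{i_1}, …, F_{i_u}` of the cone `C(S)` whose intersection
is `{0}`; here `F_i = C(S) ∩ {x : σ_i(x) = 0}`. -/
theorem grade_eq_min_facets
    {r s : ℕ} (K : Type*) [Field K]
    (S : AddSubmonoid (Fin r → ℤ)) (σ : Fin s → Fin r → ℤ)
    (hSfg : S.FG)
    (hSpos : ∀ x ∈ S, -x ∈ S → x = 0)
    (hSgp : ∀ x : Fin r → ℤ, ∃ a ∈ S, ∃ b ∈ S, x = a - b)
    (hrep : ∀ x : Fin r → ℤ, x ∈ S ↔ ∀ i, 0 ≤ lin (σ i) x)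
    (hirr : ∀ j, ∃ x : Fin r → ℤ, lin (σ j) x < 0 ∧ ∀ i, i ≠ j → 0 ≤ lin (σ i) x)
    (hprim : ∀ i, Finset.univ.gcd (σ i) = 1)
    (g : ℕ)
    (hg : IsGreatest {l : ℕ | ∃ rs : List (AddMonoidAlgebra K (Fin s → ℕ)),
      rs.length = l ∧ (∀ f ∈ rs, f ∈ extIdealP K S σ) ∧
      RingTheory.Sequence.IsRegular (AddMonoidAlgebra K (Fin s → ℕ)) rs} g) :
    IsLeast {u : ℕ | ∃ I : Finset (Fin s), I.card = u ∧
      (⋂ i ∈ I, {x ∈ coneOf (S : Set (Fin r → ℤ)) | ∑ k, (σ i k : ℝ) * x k = 0}) =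
        {0}} g := by
  simp only [iInter_facets_eq_zero_iff S σ hSgp hrep]
  obtain ⟨⟨rs, hlen, hmem, hreg⟩, hmax⟩ := hg
  have hlower : ∀ I, FacetsMeetTrivially S σ I → g ≤ I.card := fun I hI =>
    hlen ▸ length_le_card_of_facetsMeetTrivially K S σ hrep hI rs hmem hreg.toIsWeaklyRegular
  have huniv := facetsMeetTrivially_univ S σ hSpos hrep
  obtain ⟨I, hI, hmin⟩ := Set.exists_min_image {I | FacetsMeetTrivially S σ I} Finset.card
    (Set.toFinite _) ⟨_, huniv⟩
  refine ⟨⟨I, (hmax ?_).antisymm (hlower I hI), hI⟩, ?_⟩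
  · exact exists_isRegular_of_le_card K S σ hrep huniv I.card hmin
  · rintro _ ⟨J, rfl, hJ⟩
    exact hlower J hJ
end
end

section
/- Let K be a field, S a positive normal affine semigroup with gp(S) = ℤ^r, support forms σ_1,…,σ_s, and R = K[S]. For every m ∈ ℤ_+ the set of classes c ∈ Cl(R) = ℤ^s/σ(ℤ^r) for which there exists a ∈ ℤ^s with [a] = c and μ(D(a)) ≤ m is finite; equivalently, up to isomorphism there exist only finitely many divisorial ideals D with μ(D) ≤ m. -/
set_option synthInstance.maxHeartbeats 1000000
set_option maxHeartbeats 1000000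

open scoped BigOperators

noncomputable section

lemma lin_smul {r : ℕ} (f : Fin r → ℤ) (n : ℤ) (x : Fin r → ℤ) :
    lin f (n • x) = n * lin f x := by
  simp [lin, Finset.mul_sum, mul_left_comm]

lemma lin_sub {r : ℕ} (f x y : Fin r → ℤ) : lin f (x - y) = lin f x - lin f y := by
  simp [lin, mul_sub, Finset.sum_sub_distrib]

/-- A descent along a finite family of integer vectors: `V` collects the vectors already left,
and the descent cannot return to any of them because its step sizes decrease geometrically. -/
lemma exists_le_of_descent {g : ℕ} {ι : Type*} (y : Fin g → ι → ℤ) {W : ℤ} (hW : 0 ≤ W)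
    (hstep : ∀ j i (τ : ℤ), 0 ≤ τ → W * τ ≤ y j i →
      ∃ j', (∀ k, y j' k ≤ y j k + W * τ) ∧ y j' i + τ ≤ y j i)
    (n : ℕ) (hn : n ≤ g) (V : Finset (Fin g)) (j : Fin g) (hcard : g ≤ V.card + n)
    (hV : ∀ v ∈ V, ∃ i, y j i + (W + 1) ^ n ≤ y v i) :
    ∃ j', ∀ i, y j' i ≤ W * (W + 1) ^ g := by
  have hjV : j ∉ V := fun hj => by
    obtain ⟨i, hi⟩ := hV j hj
    have : 0 < (W + 1) ^ n := by positivity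
    linarith
  induction n generalizing V j with
  | zero =>
    have hVuniv : V = Finset.univ :=
      Finset.card_eq_iff_eq_univ V |>.1 (le_antisymm (Finset.card_le_univ V) (by simpa using hcard))
    exact absurd (hVuniv ▸ Finset.mem_univ j) hjV
  | succ n ih =>
    have hτ : 0 < (W + 1) ^ n := by positivity
    by_cases hsmall : ∀ i, y j i ≤ W * (W + 1) ^ n
    · refine ⟨j, fun i => (hsmall i).trans ?_⟩
      exact mul_le_mul_of_nonneg_left (pow_le_pow_right₀ (by linarith) (by omega)) hW
    · push Not at hsmall
      obtain ⟨i, hi⟩ := hsmall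
      obtain ⟨j', hle, hlt⟩ := hstep j i _ hτ.le hi.le
      have hV' : ∀ v ∈ insert j V, ∃ k, y j' k + (W + 1) ^ n ≤ y v k := by
        intro v hv
        rcases Finset.mem_insert.1 hv with rfl | hv
        · exact ⟨i, hlt⟩
        · obtain ⟨k, hk⟩ := hV v hv
          refine ⟨k, ?_⟩
          have := hle k
          rw [pow_succ] at hk
          linarith
      refine ih (by omega) (insert j V) j' ?_ hV' fun hj' => ?_
      · rw [Finset.card_insert_of_notMem hjV]
        omega
      · obtain ⟨k, hk⟩ := hV' j' hj'
        linarith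

/-- The cone `σ ≥ 0` contains an integral point at which all forms are positive. -/
lemma exists_forall_one_le_lin {r s : ℕ} (S : AddSubmonoid (Fin r → ℤ)) (σ : Fin s → Fin r → ℤ)
    (hSgp : ∀ x : Fin r → ℤ, ∃ a ∈ S, ∃ b ∈ S, x = a - b)
    (hrep : ∀ x : Fin r → ℤ, x ∈ S ↔ ∀ i, 0 ≤ lin (σ i) x)
    (hneg : ∀ j, ∃ x : Fin r → ℤ, lin (σ j) x < 0) :
    ∃ u : Fin r → ℤ, ∀ i, 1 ≤ lin (σ i) u := by
  have hpos : ∀ i, ∃ b ∈ S, 1 ≤ lin (σ i) b := fun i => by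
    obtain ⟨x, hx⟩ := hneg i
    obtain ⟨a, ha, b, hb, rfl⟩ := hSgp x
    have := (hrep a).1 ha i
    rw [lin_sub] at hx
    exact ⟨b, hb, by linarith⟩
  choose b hbS hb using hpos
  refine ⟨∑ i, b i, fun i => ?_⟩
  rw [← Finset.add_sum_erase _ _ (Finset.mem_univ i), lin_add]
  have := (hrep _).1 (S.sum_mem fun k (_ : k ∈ Finset.univ.erase i) => hbS k) i
  linarith [hb i]

lemma Tset_nonempty {r s : ℕ} (σ : Fin s → Fin r → ℤ) {u : Fin r → ℤ}
    (hu : ∀ i, 1 ≤ lin (σ i) u) (a : Fin s → ℤ) : (Tset σ a).Nonempty := by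
  refine ⟨(∑ k, |a k|) • u, fun i => ?_⟩
  rw [lin_smul]
  have hle : |a i| ≤ ∑ k, |a k| :=
    Finset.single_le_sum (fun k _ => abs_nonneg (a k)) (Finset.mem_univ i)
  nlinarith [hu i, le_abs_self (a i), abs_nonneg (a i)]

/-- Main theorem on numbers of generators.
For a positive normal affine semigroup `S` with `gp(S) = ℤ^r` and support forms
`σ_1, …, σ_s`, and every bound `m`, there are only finitely many divisor classes
`c ∈ Cl(R) = ℤ^s/σ(ℤ^r)` admitting a representative divisorial ideal `D(a)` with
`μ(D(a)) ≤ m`; here `μ(D(a)) ≤ m` means that `T(a)` is the union of at most `m`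
translates `x_i + S` with `x_i ∈ T(a)`. -/
theorem finitely_many_classes_with_few_generators
    {r s : ℕ}
    (S : AddSubmonoid (Fin r → ℤ)) (σ : Fin s → Fin r → ℤ)
    (hSfg : S.FG)
    (hSpos : ∀ x ∈ S, -x ∈ S → x = 0)
    (hSgp : ∀ x : Fin r → ℤ, ∃ a ∈ S, ∃ b ∈ S, x = a - b)
    (hrep : ∀ x : Fin r → ℤ, x ∈ S ↔ ∀ i, 0 ≤ lin (σ i) x)
    (hirr : ∀ j, ∃ x : Fin r → ℤ, lin (σ j) x < 0 ∧ ∀ i, i ≠ j → 0 ≤ lin (σ i) x)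
    (hprim : ∀ i, Finset.univ.gcd (σ i) = 1)
    (m : ℕ) :
    {c : classGroup σ | ∃ a : Fin s → ℤ, QuotientAddGroup.mk' (formsRange σ) a = c ∧
      ∃ (g : ℕ) (x : Fin g → Fin r → ℤ), g ≤ m ∧ (∀ i, x i ∈ Tset σ a) ∧
        Tset σ a = ⋃ i, (fun y => x i + y) '' (S : Set (Fin r → ℤ))}.Finite := by
  choose w hwneg hwpos using hirr
  obtain ⟨u, hu⟩ := exists_forall_one_le_lin S σ hSgp hrep fun j => ⟨w j, hwneg j⟩
  obtain ⟨W, hW⟩ : ∃ W : ℤ, ∀ p : Fin s × Fin s, |lin (σ p.1) (w p.2)| ≤ W := by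
    obtain ⟨W, hW⟩ := (Set.finite_range fun p : Fin s × Fin s => |lin (σ p.1) (w p.2)|).bddAbove
    exact ⟨W, fun p => hW ⟨p, rfl⟩⟩
  replace hW : ∀ k i, |lin (σ k) (w i)| ≤ max W 0 := fun k i => (hW (k, i)).trans (le_max_left _ _)
  have hW0 : 0 ≤ max W 0 := le_max_right _ _
  generalize max W 0 = W at hW hW0
  refine ((Set.finite_Icc (fun _ : Fin s => -(W * (W + 1) ^ m)) 0).image
    (QuotientAddGroup.mk' (formsRange σ))).subset ?_
  rintro _ ⟨a, rfl, g, x, hgm, hxT, hT⟩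
  have hcover : ∀ z ∈ Tset σ a, ∃ j, ∀ k, lin (σ k) (x j) ≤ lin (σ k) z := by
    intro z hz
    rw [hT] at hz
    obtain ⟨j, v, hv, rfl⟩ := Set.mem_iUnion.1 hz
    exact ⟨j, fun k => by rw [lin_add]; linarith [(hrep v).1 hv k]⟩
  obtain ⟨z, hz⟩ := Tset_nonempty σ hu a
  obtain ⟨j₀, -⟩ := hcover z hz
  obtain ⟨j, hj⟩ := exists_le_of_descent (fun j i => lin (σ i) (x j) - a i) hW0
    (fun j i τ hτ hle => by
      have hmem : x j + τ • w i ∈ Tset σ a := fun k => by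
        rw [lin_add, lin_smul]
        rcases eq_or_ne k i with rfl | hk
        · nlinarith [neg_abs_le (lin (σ k) (w k)), hW k k]
        · nlinarith [hwpos i k hk, hxT j k]
      obtain ⟨j', hj'⟩ := hcover _ hmem
      simp only [lin_add, lin_smul] at hj'
      refine ⟨j', fun k => ?_, ?_⟩
      · nlinarith [hj' k, le_abs_self (lin (σ k) (w i)), hW k i]
      · nlinarith [hj' i, hwneg i])
    g le_rfl ∅ j₀ (by simp) (by simp)
  refine ⟨a - formsHom σ (x j), ⟨fun i => ?_, fun i => ?_⟩, ?_⟩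
  · have hpow : W * (W + 1) ^ g ≤ W * (W + 1) ^ m :=
      mul_le_mul_of_nonneg_left (pow_le_pow_right₀ (by linarith) hgm) hW0
    change -(W * (W + 1) ^ m) ≤ a i - lin (σ i) (x j)
    linarith [hj i]
  · change a i - lin (σ i) (x j) ≤ 0
    linarith [hxT j i]
  · have hker : QuotientAddGroup.mk' (formsRange σ) (formsHom σ (x j)) = 0 :=
      (QuotientAddGroup.eq_zero_iff _).2 ⟨x j, rfl⟩
    rw [map_sub, hker, sub_zero]
end
end
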